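/- arXiv:2507.09787 — 6 statements merged into one kernel-verified Lean document; each statement's English description precedes it below -/
import Mathlib

section
/- Let H ∈ (1/3, 1/2], T > 0, α ∈ (1−2H, H) and c_x > 0. Let x : [0,T]² → ℝ satisfy |x(s,t)| ≤ c_x (t−s)^α for all 0 ≤ s ≤ t ≤ T, and |x(s,t) − x(u,v)| ≤ c_x (|s−u|^α + |t−v|^α) for all 0 ≤ s < u < t < v ≤ T. Then the function (s,t) ↦ x(s,t)(t−s)^{2H−2} is Lebesgue integrable on the triangle {(s,t) : 0 ≤ s < t ≤ T}, and for every ε > 0 there exists δ > 0 such that for every dissection 0 = t_0 < t_1 < ⋯ < t_n = T with max_{0≤j≤n−1}(t_{j+1} − t_j) < δ, one has |Σ_{j=0}^{n−1} Σ_{i=0}^{j} x(t_i, t_j) · (R(t_i,t_j) − R(t_i,t_{j+1}) − R(t_{i+1},t_j) + R(t_{i+1},t_{j+1})) − α_H ∫_0^T ∫_0^t x(s,t)(t−s)^{2H−2} ds dt| < ε. -/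
open Real MeasureTheory intervalIntegral

/-- The covariance function of fractional Brownian motion with Hurst parameter `H`:
`R(s,t) = (1/2)(s^{2H} + t^{2H} − |t−s|^{2H})`. -/
noncomputable def fbmCov (H s t : ℝ) : ℝ :=
  (1/2) * (s ^ (2*H) + t ^ (2*H) - |t - s| ^ (2*H))

lemma exists_pos_forall_mul_rpow_lt {β : ℝ} (hβ : 0 < β) (K : ℝ) {ε m : ℝ} (hε : 0 < ε)
    (hm : 0 < m) : ∃ δ, 0 < δ ∧ δ ≤ m ∧ K * δ ^ β < ε := by
  have hcont : ContinuousAt (fun d : ℝ => K * d ^ β) 0 :=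
    continuousAt_const.mul (Real.continuousAt_rpow_const 0 β (Or.inr hβ.le))
  have hlt : ∀ᶠ d in nhds (0 : ℝ), K * d ^ β < ε :=
    hcont.eventually_lt continuousAt_const (by simpa [Real.zero_rpow hβ.ne'] using hε)
  obtain ⟨r, hr, hball⟩ := Metric.eventually_nhds_iff.mp hlt
  have hpos : 0 < min m (r / 2) := lt_min hm (by linarith)
  refine ⟨min m (r / 2), hpos, min_le_left _ _, hball ?_⟩
  rw [Real.dist_eq, sub_zero, abs_of_pos hpos]
  linarith [min_le_right m (r / 2)]

lemma continuousOn_openTriangle {T α c : ℝ} (hα : 0 < α) (hc : 0 < c) {x : ℝ → ℝ → ℝ}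
    (hx : ∀ s u t v : ℝ, 0 ≤ s → s < u → u < t → t < v → v ≤ T →
      |x s t - x u v| ≤ c * (|s - u| ^ α + |t - v| ^ α)) :
    ContinuousOn (fun p : ℝ × ℝ => x p.1 p.2) {p : ℝ × ℝ | 0 < p.1 ∧ p.1 < p.2 ∧ p.2 < T} := by
  rintro ⟨s, t⟩ ⟨hs, hst, htT⟩
  simp only at hs hst htT
  refine ContinuousAt.continuousWithinAt (Metric.continuousAt_iff.mpr fun ε hε => ?_)
  have hm : 0 < min (min (2 * s) (2 * (T - t))) ((t - s) / 2) :=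
    lt_min (lt_min (by linarith) (by linarith)) (by linarith)
  obtain ⟨δ, hδ, hδm, hKδ⟩ := exists_pos_forall_mul_rpow_lt hα (4 * c) hε hm
  have h₁ := hδm.trans ((min_le_left _ _).trans (min_le_left _ _))
  have h₂ := hδm.trans ((min_le_left _ _).trans (min_le_right _ _))
  have h₃ := hδm.trans (min_le_right _ _)
  -- Every point near `(s, t)` is compared with the common upper neighbour `(s + δ/2, t + δ/2)`.
  have key : ∀ s' t', |s' - s| < δ / 2 → |t' - t| < δ / 2 →
      |x s' t' - x (s + δ / 2) (t + δ / 2)| ≤ 2 * c * δ ^ α := by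
    intro s' t' hs' ht'
    rw [abs_lt] at hs' ht'
    refine (hx s' (s + δ / 2) t' (t + δ / 2) (by linarith) (by linarith) (by linarith)
      (by linarith) (by linarith)).trans ?_
    have e₁ : |s' - (s + δ / 2)| ^ α ≤ δ ^ α :=
      Real.rpow_le_rpow (abs_nonneg _) (abs_le.mpr ⟨by linarith, by linarith⟩) hα.le
    have e₂ : |t' - (t + δ / 2)| ^ α ≤ δ ^ α :=
      Real.rpow_le_rpow (abs_nonneg _) (abs_le.mpr ⟨by linarith, by linarith⟩) hα.le
    nlinarith
  refine ⟨δ / 2, by linarith, ?_⟩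
  rintro ⟨s', t'⟩ hdist
  rw [Prod.dist_eq, max_lt_iff, Real.dist_eq, Real.dist_eq] at hdist
  have k₁ := key s' t' hdist.1 hdist.2
  have k₂ := key s t (by simpa using hδ) (by simpa using hδ)
  rw [Real.dist_eq]
  have k₃ := abs_sub_le (x s' t') (x (s + δ / 2) (t + δ / 2)) (x s t)
  rw [abs_sub_comm (x s t)] at k₂
  show |x s' t' - x s t| < ε
  linarith

lemma integrableOn_triangle_rpow {T θ : ℝ} (hT : 0 < T) (hθ : -1 < θ) :
    IntegrableOn (fun p : ℝ × ℝ => (p.2 - p.1) ^ θ)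
      {p : ℝ × ℝ | 0 < p.1 ∧ p.1 < p.2 ∧ p.2 < T} := by
  have h₁ : Integrable (Set.indicator (Set.Ioc 0 T) fun _ : ℝ => (1 : ℝ)) :=
    (integrableOn_const (by simp)).integrable_indicator measurableSet_Ioc
  have h₂ : Integrable (Set.indicator (Set.Ioc 0 T) fun r : ℝ => r ^ θ) :=
    ((intervalIntegrable_iff_integrableOn_Ioc_of_le hT.le).mp
      (intervalIntegrable_rpow' hθ)).integrable_indicator measurableSet_Ioc
  have h₃ := h₁.mul_prod h₂
  have h₄ := ((measurePreserving_prod_neg_add (volume : Measure ℝ)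
    (volume : Measure ℝ)).integrable_comp h₃.aestronglyMeasurable).mpr h₃
  have hmeas : MeasurableSet {p : ℝ × ℝ | 0 < p.1 ∧ p.1 < p.2 ∧ p.2 < T} :=
    (measurableSet_lt measurable_const measurable_fst).inter
      ((measurableSet_lt measurable_fst measurable_snd).inter
        (measurableSet_lt measurable_snd measurable_const))
  refine (h₄.integrableOn (s := {p : ℝ × ℝ | 0 < p.1 ∧ p.1 < p.2 ∧ p.2 < T})).congr_fun ?_ hmeas
  rintro ⟨s, t⟩ ⟨hs, hst, htT⟩
  simp only at hs hst htT
  have m₁ : s ∈ Set.Ioc 0 T := ⟨hs, by linarith⟩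
  have m₂ : -s + t ∈ Set.Ioc 0 T := ⟨by linarith, by linarith⟩
  simp only [Function.comp_apply, Set.indicator_of_mem m₁, Set.indicator_of_mem m₂, one_mul]
  congr 1
  ring

lemma integrableOn_triangle {T α c p : ℝ} (hT : 0 < T) (hα : 0 < α) (hc : 0 < c)
    (hαp : -1 < α + p) {x : ℝ → ℝ → ℝ}
    (hx1 : ∀ s t : ℝ, 0 ≤ s → s ≤ t → t ≤ T → |x s t| ≤ c * (t - s) ^ α)
    (hx2 : ∀ s u t v : ℝ, 0 ≤ s → s < u → u < t → t < v → v ≤ T →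
      |x s t - x u v| ≤ c * (|s - u| ^ α + |t - v| ^ α)) :
    IntegrableOn (fun q : ℝ × ℝ => x q.1 q.2 * (q.2 - q.1) ^ p)
      {q : ℝ × ℝ | 0 ≤ q.1 ∧ q.1 < q.2 ∧ q.2 ≤ T} := by
  have hmeas : MeasurableSet {p : ℝ × ℝ | 0 < p.1 ∧ p.1 < p.2 ∧ p.2 < T} :=
    (measurableSet_lt measurable_const measurable_fst).inter
      ((measurableSet_lt measurable_fst measurable_snd).inter
        (measurableSet_lt measurable_snd measurable_const))
  have hopen : IntegrableOn (fun q : ℝ × ℝ => x q.1 q.2 * (q.2 - q.1) ^ p)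
      {q : ℝ × ℝ | 0 < q.1 ∧ q.1 < q.2 ∧ q.2 < T} := by
    refine Integrable.mono' ((integrableOn_triangle_rpow hT hαp).const_mul c) ?_ ?_
    · refine ContinuousOn.aestronglyMeasurable ?_ hmeas
      refine (continuousOn_openTriangle hα hc hx2).mul ?_
      refine ContinuousOn.rpow_const (by fun_prop) fun q hq => Or.inl ?_
      exact (sub_pos.mpr hq.2.1).ne'
    · refine (ae_restrict_iff' hmeas).mpr (Filter.Eventually.of_forall ?_)
      rintro ⟨s, t⟩ ⟨hs, hst, htT⟩
      simp only at hs hst htT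
      have hpos : 0 < t - s := by linarith
      rw [Real.norm_eq_abs, abs_mul, abs_of_pos (Real.rpow_pos_of_pos hpos p),
        Real.rpow_add hpos, ← mul_assoc]
      exact mul_le_mul_of_nonneg_right (hx1 s t hs.le hst.le htT.le)
        (Real.rpow_pos_of_pos hpos p).le
  refine hopen.congr_set_ae ?_
  have e₁ : ∀ᵐ q : ℝ × ℝ, q.1 ≠ 0 :=
    (Measure.quasiMeasurePreserving_fst (μ := volume) (ν := volume)).ae
      (Measure.ae_ne volume (0 : ℝ))
  have e₂ : ∀ᵐ q : ℝ × ℝ, q.2 ≠ T :=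
    (Measure.quasiMeasurePreserving_snd (μ := volume) (ν := volume)).ae
      (Measure.ae_ne volume T)
  filter_upwards [e₁, e₂] with q h₁ h₂
  refine propext ⟨fun h => ⟨lt_of_le_of_ne h.1 h₁.symm, h.2.1, lt_of_le_of_ne h.2.2 h₂⟩,
    fun h => ⟨h.1.le, h.2.1, h.2.2.le⟩⟩

/-- Fubini on the triangle `0 ≤ s < u ≤ T`: almost every row and the row integrals are
integrable. -/
lemma rows_of_integrableOn_triangle {T : ℝ} (hT : 0 < T) {f : ℝ → ℝ → ℝ}
    (hf : IntegrableOn (fun q : ℝ × ℝ => f q.1 q.2)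
      {q : ℝ × ℝ | 0 ≤ q.1 ∧ q.1 < q.2 ∧ q.2 ≤ T}) :
    (∀ᵐ u, u ∈ Set.Ioc 0 T → IntervalIntegrable (fun s => f s u) volume 0 u) ∧
      IntervalIntegrable (fun u => ∫ s in (0 : ℝ)..u, f s u) volume 0 T := by
  have hmeas : MeasurableSet {q : ℝ × ℝ | 0 ≤ q.1 ∧ q.1 < q.2 ∧ q.2 ≤ T} :=
    (measurableSet_le measurable_const measurable_fst).inter
      ((measurableSet_lt measurable_fst measurable_snd).inter
        (measurableSet_le measurable_snd measurable_const))
  have hind := hf.integrable_indicator hmeas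
  have hrow : ∀ u ∈ Set.Ioc 0 T, (fun s => Set.indicator
      {q : ℝ × ℝ | 0 ≤ q.1 ∧ q.1 < q.2 ∧ q.2 ≤ T} (fun q => f q.1 q.2) (s, u)) =
      Set.indicator (Set.Ico 0 u) fun s => f s u := by
    intro u hu
    ext s
    simp only [Set.indicator_apply, Set.mem_ofPred_eq, Set.mem_Ico, hu.2, and_true]
  constructor
  · filter_upwards [Integrable.prod_left_ae hind] with u h hu
    rw [hrow u hu, integrable_indicator_iff measurableSet_Ico] at h
    exact (intervalIntegrable_iff_integrableOn_Ico_of_le hu.1.le).mpr h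
  · rw [intervalIntegrable_iff_integrableOn_Ioc_of_le hT.le]
    refine (Integrable.integral_prod_right hind).integrableOn.congr_fun ?_ measurableSet_Ioc
    intro u hu
    simp only
    rw [hrow u hu, MeasureTheory.integral_indicator measurableSet_Ico, integral_of_le hu.1.le,
      integral_Ico_eq_integral_Ioo, integral_Ioc_eq_integral_Ioo]

lemma integral_sub_rpow {H a b u : ℝ} (hab : a ≤ b) (hbu : b < u) :
    H * (2 * H - 1) * ∫ s in a..b, (u - s) ^ (2 * H - 2) =
      H * ((u - a) ^ (2 * H - 1) - (u - b) ^ (2 * H - 1)) := by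
  have hne : ∀ s ∈ Set.uIcc a b, u - s ≠ 0 := fun s hs => by
    rw [Set.uIcc_of_le hab] at hs
    exact (sub_pos.mpr (hs.2.trans_lt hbu)).ne'
  have hderiv : ∀ s ∈ Set.uIcc a b, HasDerivAt (fun s => -(H * (u - s) ^ (2 * H - 1)))
      (H * (2 * H - 1) * (u - s) ^ (2 * H - 2)) s := by
    intro s hs
    have h := ((((hasDerivAt_id' s).const_sub u).rpow_const (p := 2 * H - 1)
      (Or.inl (hne s hs))).const_mul H).fun_neg
    refine h.congr_deriv ?_
    rw [show 2 * H - 1 - 1 = 2 * H - 2 by ring]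
    ring
  have hint : IntervalIntegrable (fun s => H * (2 * H - 1) * (u - s) ^ (2 * H - 2)) volume a b :=
    ContinuousOn.intervalIntegrable (continuousOn_const.mul
      (ContinuousOn.rpow_const (by fun_prop) fun s hs => Or.inl (hne s hs)))
  rw [← intervalIntegral.integral_const_mul, integral_eq_sub_of_hasDerivAt hderiv hint]
  ring

lemma intervalIntegrable_sub_rpow {r : ℝ} (hr : -1 < r) (a c d : ℝ) :
    IntervalIntegrable (fun u => (u - a) ^ r) volume c d := by
  simpa using (intervalIntegrable_rpow' (a := c - a) (b := d - a) hr).comp_sub_right a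

lemma integral_rpow_sub_right {H : ℝ} (hH : 0 < H) (a c d : ℝ) :
    ∫ u in c..d, H * (u - a) ^ (2 * H - 1) =
      (1 / 2) * ((d - a) ^ (2 * H) - (c - a) ^ (2 * H)) := by
  rw [intervalIntegral.integral_const_mul,
    intervalIntegral.integral_comp_sub_right (fun u => u ^ (2 * H - 1)),
    integral_rpow (Or.inl (by linarith)), show 2 * H - 1 + 1 = 2 * H by ring]
  field_simp

lemma abs_cell_sub_integral_le {H a b u m M : ℝ} (hH0 : 0 ≤ H) (hH : H ≤ 1 / 2) (hab : a ≤ b)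
    (hbu : b < u) {f : ℝ → ℝ} (hf : ∀ s ∈ Set.Ioo a b, |m - f s| ≤ M)
    (hint : IntervalIntegrable (fun s => f s * (u - s) ^ (2 * H - 2)) volume a b) :
    |m * (H * ((u - a) ^ (2 * H - 1) - (u - b) ^ (2 * H - 1))) -
        H * (2 * H - 1) * ∫ s in a..b, f s * (u - s) ^ (2 * H - 2)| ≤
      M * -(H * ((u - a) ^ (2 * H - 1) - (u - b) ^ (2 * H - 1))) := by
  have hk : IntervalIntegrable (fun s => (u - s) ^ (2 * H - 2)) volume a b := by
    refine ContinuousOn.intervalIntegrable (ContinuousOn.rpow_const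
      (continuousOn_const.sub continuousOn_id) fun s hs => Or.inl ?_)
    rw [Set.uIcc_of_le hab] at hs
    exact (sub_pos.mpr (hs.2.trans_lt hbu)).ne'
  have hneg : H * (2 * H - 1) ≤ 0 := mul_nonpos_of_nonneg_of_nonpos hH0 (by linarith)
  have hle : ‖∫ s in a..b, (m * (u - s) ^ (2 * H - 2) - f s * (u - s) ^ (2 * H - 2))‖ ≤
      ∫ s in a..b, M * (u - s) ^ (2 * H - 2) := by
    refine norm_integral_le_of_norm_le hab ?_ (hk.const_mul M)
    filter_upwards [Measure.ae_ne volume b] with s hsb hs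
    have hpos : 0 < u - s := by linarith [hs.2]
    rw [← sub_mul, Real.norm_eq_abs, abs_mul, abs_of_pos (Real.rpow_pos_of_pos hpos _)]
    exact mul_le_mul_of_nonneg_right (hf s ⟨hs.1, lt_of_le_of_ne hs.2 hsb⟩)
      (Real.rpow_pos_of_pos hpos _).le
  rw [intervalIntegral.integral_sub (hk.const_mul m) hint, intervalIntegral.integral_const_mul,
    intervalIntegral.integral_const_mul, Real.norm_eq_abs] at hle
  rw [← integral_sub_rpow hab hbu]
  have e : ∀ I J : ℝ, m * (H * (2 * H - 1) * I) - H * (2 * H - 1) * J =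
      H * (2 * H - 1) * (m * I - J) := fun I J => by ring
  rw [e, abs_mul, abs_of_nonpos hneg]
  nlinarith [mul_le_mul_of_nonneg_left hle (neg_nonneg.mpr hneg)]

lemma abs_integral_diagonal_le {α c p a u : ℝ} (hαp : -1 < α + p) (hau : a ≤ u) {f : ℝ → ℝ}
    (hf : ∀ s, a < s → s < u → |f s| ≤ c * (u - s) ^ α) :
    |∫ s in a..u, f s * (u - s) ^ p| ≤ c / (α + p + 1) * (u - a) ^ (α + p + 1) := by
  have hint : IntervalIntegrable (fun s => c * (u - s) ^ (α + p)) volume a u := by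
    have h := (intervalIntegrable_rpow' (a := u - a) (b := 0) hαp).comp_sub_left u
    simpa using h.const_mul c
  have hle : ‖∫ s in a..u, f s * (u - s) ^ p‖ ≤ ∫ s in a..u, c * (u - s) ^ (α + p) := by
    refine norm_integral_le_of_norm_le hau ?_ hint
    filter_upwards [Measure.ae_ne volume u] with s hsu hs
    have hlt := lt_of_le_of_ne hs.2 hsu
    have hpos : 0 < u - s := by linarith
    rw [Real.norm_eq_abs, abs_mul, abs_of_pos (Real.rpow_pos_of_pos hpos p),
      Real.rpow_add hpos, ← mul_assoc]
    exact mul_le_mul_of_nonneg_right (hf s hs.1 hlt) (Real.rpow_pos_of_pos hpos p).le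
  rw [Real.norm_eq_abs] at hle
  refine hle.trans (le_of_eq ?_)
  rw [intervalIntegral.integral_const_mul,
    intervalIntegral.integral_comp_sub_left (fun r => r ^ (α + p)), sub_self,
    integral_rpow (Or.inl hαp), Real.zero_rpow (by linarith)]
  ring

lemma abs_row_sub_integral_le {H α c u : ℝ} (hH0 : 0 ≤ H) (hH : H ≤ 1 / 2)
    (hα : -1 < α + (2 * H - 2)) {t : ℕ → ℝ} {j : ℕ} (ht : ∀ i < j, t i < t (i + 1))
    (hju : t j < u) {f : ℝ → ℝ} {m M : ℕ → ℝ}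
    (hm : ∀ i < j, ∀ s ∈ Set.Ioo (t i) (t (i + 1)), |m i - f s| ≤ M i)
    (hf : ∀ s, t j < s → s < u → |f s| ≤ c * (u - s) ^ α)
    (hint : IntervalIntegrable (fun s => f s * (u - s) ^ (2 * H - 2)) volume (t 0) u) :
    |∑ i ∈ Finset.range j, m i * (H * ((u - t i) ^ (2 * H - 1) - (u - t (i + 1)) ^ (2 * H - 1))) -
        H * (2 * H - 1) * ∫ s in (t 0)..u, f s * (u - s) ^ (2 * H - 2)| ≤
      ∑ i ∈ Finset.range j,
        M i * -(H * ((u - t i) ^ (2 * H - 1) - (u - t (i + 1)) ^ (2 * H - 1))) +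
      |H * (2 * H - 1)| * (c / (α + (2 * H - 2) + 1) * (u - t j) ^ (α + (2 * H - 2) + 1)) := by
  have hmono : MonotoneOn t (Set.Iic j) := monotoneOn_of_le_add_one Set.ordConnected_Iic
    fun i _ _ hi => (ht i (Nat.lt_of_succ_le hi)).le
  have hlow : ∀ i ≤ j, t 0 ≤ t i := fun i hi => hmono (Nat.zero_le j) hi (Nat.zero_le i)
  have hupp : ∀ i ≤ j, t i ≤ t j := fun i hi => hmono hi (Set.mem_Iic.mpr le_rfl) hi
  have hsub : ∀ a b, t 0 ≤ a → a ≤ b → b ≤ u →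
      IntervalIntegrable (fun s => f s * (u - s) ^ (2 * H - 2)) volume a b := fun a b ha hab hb =>
    hint.mono_set (by
      rw [Set.uIcc_of_le hab, Set.uIcc_of_le (ha.trans (hab.trans hb))]
      exact Set.Icc_subset_Icc ha hb)
  have hcell : ∀ i < j, IntervalIntegrable (fun s => f s * (u - s) ^ (2 * H - 2)) volume
      (t i) (t (i + 1)) := fun i hi =>
    hsub _ _ (hlow i hi.le) (ht i hi).le ((hupp (i + 1) hi).trans hju.le)
  have hsplit : ∫ s in (t 0)..u, f s * (u - s) ^ (2 * H - 2) =
      ∑ i ∈ Finset.range j, (∫ s in (t i)..(t (i + 1)), f s * (u - s) ^ (2 * H - 2)) +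
        ∫ s in (t j)..u, f s * (u - s) ^ (2 * H - 2) := by
    rw [sum_integral_adjacent_intervals hcell, integral_add_adjacent_intervals
      (hsub _ _ le_rfl (hlow j le_rfl) hju.le) (hsub _ _ (hlow j le_rfl) hju.le le_rfl)]
  rw [hsplit, mul_add, Finset.mul_sum, ← sub_sub, ← Finset.sum_sub_distrib]
  refine (abs_sub _ _).trans (add_le_add ?_ ?_)
  · refine (Finset.abs_sum_le_sum_abs _ _).trans (Finset.sum_le_sum fun i hi => ?_)
    have hi := Finset.mem_range.mp hi
    exact abs_cell_sub_integral_le hH0 hH (ht i hi).le ((hupp (i + 1) hi).trans_lt hju)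
      (hm i hi) (hcell i hi)
  · rw [abs_mul]
    exact mul_le_mul_of_nonneg_left (abs_integral_diagonal_le hα hju.le hf) (abs_nonneg _)

/-- The increment of `(s, t) ↦ -|t - s|^{2H} / 2` over the rectangle `[a, b] × [c, d]` lying
above the diagonal. -/
noncomputable def rectIncrement (H a b c d : ℝ) : ℝ :=
  (1 / 2) * ((d - a) ^ (2 * H) - (c - a) ^ (2 * H)) -
    (1 / 2) * ((d - b) ^ (2 * H) - (c - b) ^ (2 * H))

lemma fbmCov_rect_eq_rectIncrement {H a b c d : ℝ} (hab : a ≤ b) (hbc : b ≤ c) (hcd : c ≤ d) :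
    fbmCov H a c - fbmCov H a d - fbmCov H b c + fbmCov H b d = rectIncrement H a b c d := by
  unfold fbmCov rectIncrement
  rw [abs_of_nonneg (by linarith : 0 ≤ c - a), abs_of_nonneg (by linarith : 0 ≤ d - a),
    abs_of_nonneg (by linarith : 0 ≤ c - b), abs_of_nonneg (by linarith : 0 ≤ d - b)]
  ring

lemma intervalIntegrable_cell {H : ℝ} (hH : 0 < H) (a b c d : ℝ) :
    IntervalIntegrable (fun u => H * ((u - a) ^ (2 * H - 1) - (u - b) ^ (2 * H - 1)))
      volume c d :=
  ((intervalIntegrable_sub_rpow (by linarith) a c d).sub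
    (intervalIntegrable_sub_rpow (by linarith) b c d)).const_mul H

lemma integral_cell {H : ℝ} (hH : 0 < H) (a b c d : ℝ) :
    ∫ u in c..d, H * ((u - a) ^ (2 * H - 1) - (u - b) ^ (2 * H - 1)) =
      rectIncrement H a b c d := by
  simp only [mul_sub]
  rw [intervalIntegral.integral_sub
      ((intervalIntegrable_sub_rpow (by linarith) a c d).const_mul H)
      ((intervalIntegrable_sub_rpow (by linarith) b c d).const_mul H),
    integral_rpow_sub_right hH, integral_rpow_sub_right hH, rectIncrement]

lemma abs_column_sub_integral_le {H α c : ℝ} (hH0 : 0 < H) (hH : H ≤ 1 / 2) (hc : 0 ≤ c)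
    (hα : -1 < α + (2 * H - 2)) {t : ℕ → ℝ} {j : ℕ} (ht : ∀ i ≤ j, t i < t (i + 1))
    {f : ℝ → ℝ → ℝ} {m M : ℕ → ℝ}
    (hm : ∀ i < j, ∀ s ∈ Set.Ioo (t i) (t (i + 1)), ∀ u ∈ Set.Ioc (t j) (t (j + 1)),
      |m i - f s u| ≤ M i)
    (hf : ∀ s, ∀ u ∈ Set.Ioc (t j) (t (j + 1)), t j < s → s < u → |f s u| ≤ c * (u - s) ^ α)
    (hrow : ∀ᵐ u, u ∈ Set.Ioc (t j) (t (j + 1)) →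
      IntervalIntegrable (fun s => f s u * (u - s) ^ (2 * H - 2)) volume (t 0) u)
    (hcol : IntervalIntegrable (fun u => ∫ s in (t 0)..u, f s u * (u - s) ^ (2 * H - 2)) volume
      (t j) (t (j + 1))) :
    |∑ i ∈ Finset.range j, m i * rectIncrement H (t i) (t (i + 1)) (t j) (t (j + 1)) -
        H * (2 * H - 1) *
          ∫ u in (t j)..(t (j + 1)), ∫ s in (t 0)..u, f s u * (u - s) ^ (2 * H - 2)| ≤
      ∑ i ∈ Finset.range j, M i * -rectIncrement H (t i) (t (i + 1)) (t j) (t (j + 1)) +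
      |H * (2 * H - 1)| * (c / (α + (2 * H - 2) + 1)) *
        ((t (j + 1) - t j) ^ (α + (2 * H - 2) + 1) * (t (j + 1) - t j)) := by
  have hβ : 0 < α + (2 * H - 2) + 1 := by linarith
  set C := |H * (2 * H - 1)| * (c / (α + (2 * H - 2) + 1)) with hC
  have hC0 : 0 ≤ C := by positivity
  have hcell := fun i : ℕ => intervalIntegrable_cell hH0 (t i) (t (i + 1)) (t j) (t (j + 1))
  have hsum : ∀ w : ℕ → ℝ, IntervalIntegrable (fun u => ∑ i ∈ Finset.range j,
      w i * (H * ((u - t i) ^ (2 * H - 1) - (u - t (i + 1)) ^ (2 * H - 1)))) volume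
      (t j) (t (j + 1)) := fun w => by
    simpa only [Finset.sum_fn] using
      IntervalIntegrable.sum (Finset.range j) fun i _ => (hcell i).const_mul (w i)
  have heval : ∀ w : ℕ → ℝ, ∫ u in (t j)..(t (j + 1)), ∑ i ∈ Finset.range j,
      w i * (H * ((u - t i) ^ (2 * H - 1) - (u - t (i + 1)) ^ (2 * H - 1))) =
      ∑ i ∈ Finset.range j, w i * rectIncrement H (t i) (t (i + 1)) (t j) (t (j + 1)) := by
    intro w
    rw [intervalIntegral.integral_finsetSum fun i _ => (hcell i).const_mul (w i)]
    simp only [intervalIntegral.integral_const_mul, integral_cell hH0]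
  have hM : ∀ u, ∑ i ∈ Finset.range j,
      M i * -(H * ((u - t i) ^ (2 * H - 1) - (u - t (i + 1)) ^ (2 * H - 1))) =
      ∑ i ∈ Finset.range j,
        (-M i) * (H * ((u - t i) ^ (2 * H - 1) - (u - t (i + 1)) ^ (2 * H - 1))) := fun u =>
    Finset.sum_congr rfl fun i _ => by ring
  have hle : ‖∫ u in (t j)..(t (j + 1)), (∑ i ∈ Finset.range j,
        m i * (H * ((u - t i) ^ (2 * H - 1) - (u - t (i + 1)) ^ (2 * H - 1))) -
      H * (2 * H - 1) * ∫ s in (t 0)..u, f s u * (u - s) ^ (2 * H - 2))‖ ≤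
      ∫ u in (t j)..(t (j + 1)), (∑ i ∈ Finset.range j,
        (-M i) * (H * ((u - t i) ^ (2 * H - 1) - (u - t (i + 1)) ^ (2 * H - 1))) +
      C * (t (j + 1) - t j) ^ (α + (2 * H - 2) + 1)) := by
    refine norm_integral_le_of_norm_le (ht j le_rfl).le ?_
      ((hsum _).add intervalIntegrable_const)
    filter_upwards [hrow] with u hu huj
    have h := abs_row_sub_integral_le (c := c) hH0.le hH hα (fun i hi => ht i hi.le) huj.1
      (fun i hi s hs => hm i hi s hs u huj) (fun s => hf s u huj) (hu huj)
    rw [← hM, Real.norm_eq_abs]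
    refine h.trans (add_le_add le_rfl ?_)
    rw [hC, mul_assoc]
    have hpow : (u - t j) ^ (α + (2 * H - 2) + 1) ≤
        (t (j + 1) - t j) ^ (α + (2 * H - 2) + 1) :=
      Real.rpow_le_rpow (by linarith [huj.1]) (by linarith [huj.2]) hβ.le
    gcongr
  rw [intervalIntegral.integral_sub (hsum m) (hcol.const_mul _),
    intervalIntegral.integral_add (hsum _) intervalIntegrable_const, heval, heval,
    intervalIntegral.integral_const_mul, intervalIntegral.integral_const, Real.norm_eq_abs] at hle
  refine hle.trans (le_of_eq ?_)
  rw [smul_eq_mul]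
  congr 1
  · exact Finset.sum_congr rfl fun i _ => by ring
  · ring

lemma sum_neg_rectIncrement_row_le {H : ℝ} (hH0 : 0 < H) {t : ℕ → ℝ} {j : ℕ}
    (h0 : t 0 ≤ t j) (hj : t j ≤ t (j + 1)) :
    ∑ i ∈ Finset.range j, -rectIncrement H (t i) (t (i + 1)) (t j) (t (j + 1)) ≤
      (1 / 2) * (t (j + 1) - t j) ^ (2 * H) := by
  have h := Finset.sum_range_sub
    (fun i => (1 / 2) * ((t (j + 1) - t i) ^ (2 * H) - (t j - t i) ^ (2 * H))) j
  simp only [rectIncrement, neg_sub]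
  rw [h, sub_self, Real.zero_rpow (by linarith)]
  have hpow : (t j - t 0) ^ (2 * H) ≤ (t (j + 1) - t 0) ^ (2 * H) :=
    Real.rpow_le_rpow (by linarith) (by linarith) (by linarith)
  linarith

lemma sum_neg_rectIncrement_column_le {H : ℝ} (hH0 : 0 < H) {t : ℕ → ℝ} {i n : ℕ}
    (hin : i + 1 ≤ n) (hi : t i ≤ t (i + 1)) (hn : t (i + 1) ≤ t n) :
    ∑ j ∈ Finset.Ico (i + 1) n, -rectIncrement H (t i) (t (i + 1)) (t j) (t (j + 1)) ≤
      (1 / 2) * (t (i + 1) - t i) ^ (2 * H) := by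
  have h := Finset.sum_Ico_sub
    (fun j => (1 / 2) * ((t j - t (i + 1)) ^ (2 * H) - (t j - t i) ^ (2 * H))) hin
  have e : ∀ j, -rectIncrement H (t i) (t (i + 1)) (t j) (t (j + 1)) =
      (1 / 2) * ((t (j + 1) - t (i + 1)) ^ (2 * H) - (t (j + 1) - t i) ^ (2 * H)) -
        (1 / 2) * ((t j - t (i + 1)) ^ (2 * H) - (t j - t i) ^ (2 * H)) := fun j => by
    unfold rectIncrement
    ring
  rw [Finset.sum_congr rfl fun j _ => e j, h, sub_self, Real.zero_rpow (by linarith)]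
  have hpow : (t n - t (i + 1)) ^ (2 * H) ≤ (t n - t i) ^ (2 * H) :=
    Real.rpow_le_rpow (by linarith) (by linarith) (by linarith)
  linarith

lemma sum_weighted_rectIncrement_le {H : ℝ} (hH0 : 0 < H) {t : ℕ → ℝ} {n : ℕ}
    (ht : ∀ j < n, t j < t (j + 1)) {w : ℕ → ℝ} (hw : ∀ j < n, 0 ≤ w j) :
    ∑ j ∈ Finset.range n, ∑ i ∈ Finset.range j,
        (w i + w j) * -rectIncrement H (t i) (t (i + 1)) (t j) (t (j + 1)) ≤
      ∑ j ∈ Finset.range n, w j * (t (j + 1) - t j) ^ (2 * H) := by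
  have hmono : MonotoneOn t (Set.Iic n) := monotoneOn_of_le_add_one Set.ordConnected_Iic
    fun i _ _ hi => (ht i (Nat.lt_of_succ_le hi)).le
  have hswap : ∑ j ∈ Finset.range n, ∑ i ∈ Finset.range j,
      w i * -rectIncrement H (t i) (t (i + 1)) (t j) (t (j + 1)) =
      ∑ i ∈ Finset.range n, ∑ j ∈ Finset.Ico (i + 1) n,
        w i * -rectIncrement H (t i) (t (i + 1)) (t j) (t (j + 1)) :=
    Finset.sum_comm' fun j i => by
      simp only [Finset.mem_range, Finset.mem_Ico]
      omega
  simp only [add_mul, Finset.sum_add_distrib]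
  rw [hswap]
  simp only [← Finset.mul_sum]
  rw [← Finset.sum_add_distrib]
  refine Finset.sum_le_sum fun j hj => ?_
  have hj := Finset.mem_range.mp hj
  have h₁ := sum_neg_rectIncrement_row_le hH0
    (hmono (Nat.zero_le n) hj.le (Nat.zero_le j)) (ht j hj).le
  have h₂ := sum_neg_rectIncrement_column_le hH0 hj (ht j hj).le
    (hmono (Set.mem_Iic.mpr hj) (Set.mem_Iic.mpr le_rfl) hj)
  nlinarith [mul_le_mul_of_nonneg_left h₁ (hw j hj), mul_le_mul_of_nonneg_left h₂ (hw j hj)]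

/-- Let `H ∈ (1/3, 1/2]`, `T > 0`, `α ∈ (1−2H, H)` and `c_x > 0`. Let
`x : [0,T]² → ℝ` satisfy `|x(s,t)| ≤ c_x (t−s)^α` for `0 ≤ s ≤ t ≤ T` and
`|x(s,t) − x(u,v)| ≤ c_x (|s−u|^α + |t−v|^α)` for `0 ≤ s < u < t < v ≤ T`. Then
`(s,t) ↦ x(s,t)(t−s)^{2H−2}` is Lebesgue integrable on the triangle
`{(s,t) : 0 ≤ s < t ≤ T}`, and for every `ε > 0` there is `δ > 0` such that every dissection
`0 = t_0 < ⋯ < t_n = T` of mesh `< δ` has its double Riemann sum against the rectangular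
increments of the fBm covariance `R` within `ε` of
`α_H ∫_0^T ∫_0^t x(s,t)(t−s)^{2H−2} ds dt`, where `α_H = H(2H−1)`. -/
theorem stmt0 (H T α cx : ℝ) (hH1 : 1/3 < H) (hH2 : H ≤ 1/2) (hT : 0 < T)
    (hα1 : 1 - 2*H < α) (hα2 : α < H) (hcx : 0 < cx)
    (x : ℝ → ℝ → ℝ)
    (hx1 : ∀ s t : ℝ, 0 ≤ s → s ≤ t → t ≤ T → |x s t| ≤ cx * (t - s) ^ α)
    (hx2 : ∀ s u t v : ℝ, 0 ≤ s → s < u → u < t → t < v → v ≤ T →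
      |x s t - x u v| ≤ cx * (|s - u| ^ α + |t - v| ^ α)) :
    IntegrableOn (fun p : ℝ × ℝ => x p.1 p.2 * (p.2 - p.1) ^ (2*H - 2))
      {p : ℝ × ℝ | 0 ≤ p.1 ∧ p.1 < p.2 ∧ p.2 ≤ T} ∧
    ∀ ε : ℝ, 0 < ε → ∃ δ : ℝ, 0 < δ ∧
      ∀ (n : ℕ) (t : ℕ → ℝ), 0 < n → t 0 = 0 → t n = T →
        (∀ j < n, t j < t (j+1)) → (∀ j < n, t (j+1) - t j < δ) →
        |(∑ j ∈ Finset.range n, ∑ i ∈ Finset.range (j+1),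
            x (t i) (t j) *
              (fbmCov H (t i) (t j) - fbmCov H (t i) (t (j+1))
                - fbmCov H (t (i+1)) (t j) + fbmCov H (t (i+1)) (t (j+1))))
          - H * (2*H - 1) *
              ∫ u in (0:ℝ)..T, ∫ s in (0:ℝ)..u, x s u * (u - s) ^ (2*H - 2)| < ε := by
  have hα0 : 0 < α := by linarith
  have hH0 : 0 < H := by linarith
  have hθ : -1 < α + (2 * H - 2) := by linarith
  have hint := integrableOn_triangle hT hα0 hcx hθ hx1 hx2
  refine ⟨hint, fun ε hε => ?_⟩
  obtain ⟨hrow, hcol⟩ := rows_of_integrableOn_triangle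
    (f := fun s u => x s u * (u - s) ^ (2 * H - 2)) hT hint
  set β := α + (2 * H - 2) + 1 with hβ
  have hβ0 : 0 < β := by linarith
  set C := |H * (2 * H - 1)| * (cx / β) with hC
  have hC0 : 0 ≤ C := by positivity
  obtain ⟨δ, hδ, -, hKδ⟩ := exists_pos_forall_mul_rpow_lt hβ0 ((cx + C) * T) hε one_pos
  refine ⟨δ, hδ, fun n t hn ht0 htn ht hmesh => ?_⟩
  have hmono : MonotoneOn t (Set.Iic n) := monotoneOn_of_le_add_one Set.ordConnected_Iic
    fun i _ _ hi => (ht i (Nat.lt_of_succ_le hi)).le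
  have hle : ∀ {i j}, i ≤ j → j ≤ n → t i ≤ t j := fun hij hj =>
    hmono (Set.mem_Iic.mpr (hij.trans hj)) (Set.mem_Iic.mpr hj) hij
  have hnonneg : ∀ i ≤ n, 0 ≤ t i := fun i hi => ht0 ▸ hle (Nat.zero_le i) hi
  have hleT : ∀ i ≤ n, t i ≤ T := fun i hi => htn ▸ hle hi le_rfl
  have hcolj : ∀ j < n, IntervalIntegrable
      (fun u => ∫ s in (0 : ℝ)..u, x s u * (u - s) ^ (2 * H - 2)) volume (t j) (t (j + 1)) :=
    fun j hj => hcol.mono_set (by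
      rw [Set.uIcc_of_le (ht j hj).le, Set.uIcc_of_le hT.le]
      exact Set.Icc_subset_Icc (hnonneg j hj.le) (hleT (j + 1) hj))
  have hintegral : ∫ u in (0 : ℝ)..T, ∫ s in (0 : ℝ)..u, x s u * (u - s) ^ (2 * H - 2) =
      ∑ j ∈ Finset.range n, ∫ u in (t j)..(t (j + 1)), ∫ s in (0 : ℝ)..u,
        x s u * (u - s) ^ (2 * H - 2) := by
    rw [sum_integral_adjacent_intervals hcolj, ht0, htn]
  have hsum : ∑ j ∈ Finset.range n, ∑ i ∈ Finset.range (j + 1), x (t i) (t j) *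
      (fbmCov H (t i) (t j) - fbmCov H (t i) (t (j + 1))
        - fbmCov H (t (i + 1)) (t j) + fbmCov H (t (i + 1)) (t (j + 1))) =
      ∑ j ∈ Finset.range n, ∑ i ∈ Finset.range j,
        x (t i) (t j) * rectIncrement H (t i) (t (i + 1)) (t j) (t (j + 1)) := by
    refine Finset.sum_congr rfl fun j hj => ?_
    have hj := Finset.mem_range.mp hj
    have hdiag : x (t j) (t j) = 0 := by
      have h := hx1 (t j) (t j) (hnonneg j hj.le) le_rfl (hleT j hj.le)
      rwa [sub_self, Real.zero_rpow hα0.ne', mul_zero, abs_nonpos_iff] at h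
    rw [Finset.sum_range_succ, hdiag, zero_mul, add_zero]
    refine Finset.sum_congr rfl fun i hi => ?_
    have hi := Finset.mem_range.mp hi
    rw [fbmCov_rect_eq_rectIncrement (ht i (hi.trans hj)).le (hle hi hj.le) (ht j hj).le]
  have hcolumn : ∀ j < n,
      |∑ i ∈ Finset.range j,
          x (t i) (t j) * rectIncrement H (t i) (t (i + 1)) (t j) (t (j + 1)) -
        H * (2 * H - 1) *
          ∫ u in (t j)..(t (j + 1)), ∫ s in (0 : ℝ)..u, x s u * (u - s) ^ (2 * H - 2)| ≤
      ∑ i ∈ Finset.range j, cx * ((t (i + 1) - t i) ^ α + (t (j + 1) - t j) ^ α) *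
          -rectIncrement H (t i) (t (i + 1)) (t j) (t (j + 1)) +
        C * ((t (j + 1) - t j) ^ β * (t (j + 1) - t j)) := by
    intro j hj
    have h := abs_column_sub_integral_le (c := cx) (f := x) (m := fun i => x (t i) (t j))
      (M := fun i => cx * ((t (i + 1) - t i) ^ α + (t (j + 1) - t j) ^ α)) hH0 hH2 hcx.le hθ
      (t := t) (j := j) (fun i hi => ht i (hi.trans_lt hj)) ?_ ?_ ?_ ?_
    · simpa only [ht0] using h
    · intro i hi s hs u hu
      have hsj : s < t j := hs.2.trans_le (hle hi hj.le)
      refine (hx2 (t i) s (t j) u (hnonneg i (hi.trans hj).le) hs.1 hsj hu.1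
        (hu.2.trans (hleT (j + 1) hj))).trans (mul_le_mul_of_nonneg_left ?_ hcx.le)
      rw [abs_sub_comm, abs_of_pos (sub_pos.mpr hs.1), abs_sub_comm,
        abs_of_pos (sub_pos.mpr hu.1)]
      exact add_le_add
        (Real.rpow_le_rpow (sub_pos.mpr hs.1).le (by linarith [hs.2]) hα0.le)
        (Real.rpow_le_rpow (sub_pos.mpr hu.1).le (by linarith [hu.2]) hα0.le)
    · intro s u hu hjs hsu
      exact hx1 s u ((hnonneg j hj.le).trans hjs.le) hsu.le (hu.2.trans (hleT (j + 1) hj))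
    · rw [ht0]
      filter_upwards [hrow] with u h hu
      exact h ⟨(hnonneg j hj.le).trans_lt hu.1, hu.2.trans (hleT (j + 1) hj)⟩
    · rw [ht0]
      exact hcolj j hj
  have hpow : ∀ j < n, (t (j + 1) - t j) ^ α * (t (j + 1) - t j) ^ (2 * H) =
      (t (j + 1) - t j) ^ β * (t (j + 1) - t j) := fun j hj => by
    have hpos : 0 < t (j + 1) - t j := sub_pos.mpr (ht j hj)
    rw [← Real.rpow_add hpos, ← Real.rpow_add_one hpos.ne']
    congr 1
    rw [hβ]
    ring
  have hmeshsum : ∑ j ∈ Finset.range n, (t (j + 1) - t j) ^ β * (t (j + 1) - t j) ≤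
      δ ^ β * T := by
    have htel := Finset.sum_range_sub t n
    rw [ht0, htn, sub_zero] at htel
    rw [← htel, Finset.mul_sum]
    refine Finset.sum_le_sum fun j hj => ?_
    have hj := Finset.mem_range.mp hj
    have hpos : 0 ≤ t (j + 1) - t j := (sub_pos.mpr (ht j hj)).le
    exact mul_le_mul_of_nonneg_right (Real.rpow_le_rpow hpos (hmesh j hj).le hβ0.le) hpos
  have hweighted := sum_weighted_rectIncrement_le hH0 ht
    (w := fun j => (t (j + 1) - t j) ^ α)
    fun j hj => Real.rpow_nonneg (sub_pos.mpr (ht j hj)).le α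
  rw [Finset.sum_congr rfl fun j hj => hpow j (Finset.mem_range.mp hj)] at hweighted
  rw [hsum, hintegral, Finset.mul_sum, ← Finset.sum_sub_distrib]
  calc _ ≤ _ := Finset.abs_sum_le_sum_abs _ _
    _ ≤ _ := Finset.sum_le_sum fun j hj => hcolumn j (Finset.mem_range.mp hj)
    _ = cx * ∑ j ∈ Finset.range n, ∑ i ∈ Finset.range j,
          ((t (i + 1) - t i) ^ α + (t (j + 1) - t j) ^ α) *
            -rectIncrement H (t i) (t (i + 1)) (t j) (t (j + 1)) +
        C * ∑ j ∈ Finset.range n, (t (j + 1) - t j) ^ β * (t (j + 1) - t j) := by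
      simp only [Finset.sum_add_distrib, Finset.mul_sum, mul_assoc]
    _ ≤ cx * (δ ^ β * T) + C * (δ ^ β * T) :=
      add_le_add (mul_le_mul_of_nonneg_left (hweighted.trans hmeshsum) hcx.le)
        (mul_le_mul_of_nonneg_left hmeshsum hC0)
    _ = (cx + C) * T * δ ^ β := by ring
    _ < ε := hKδ
end

section
/- Let H ∈ (1/3, 1/2], T > 0, α ∈ (1−2H, H) and c_x > 0. Let x : [0,T]² → ℝ satisfy |x(s,t)| ≤ c_x (t−s)^α for all 0 ≤ s ≤ t ≤ T. Then for every dissection 0 = t_0 < t_1 < ⋯ < t_n = T, |Σ_{j=1}^{n−1} x(t_{j−1}, t_j) · (1/2)((t_{j+1}−t_{j−1})^{2H} − (t_{j+1}−t_j)^{2H} − (t_j−t_{j−1})^{2H})| ≤ 2 c_x T · max_{1≤j≤n} (t_j − t_{j−1})^{α+2H−1}. -/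
open Real

/-- For `0 < p ≤ 1`, the defect of additivity of `u ↦ u ^ p` is bounded by `a ^ p`. -/
lemma abs_add_rpow_sub_rpow_sub_rpow_le {p a b : ℝ} (hp0 : 0 < p) (hp1 : p ≤ 1)
    (ha : 0 ≤ a) (hb : 0 ≤ b) : |(a + b) ^ p - b ^ p - a ^ p| ≤ a ^ p := by
  have h1 : (a + b) ^ p ≤ a ^ p + b ^ p := Real.rpow_add_le_add_rpow ha hb hp0.le hp1
  have h2 : b ^ p ≤ (a + b) ^ p := Real.rpow_le_rpow hb (by linarith) hp0.le
  rw [abs_le]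
  constructor <;> linarith [Real.rpow_nonneg ha p]

/-- A real sequence that increases at each step below `n` is monotone up to `n`. -/
lemma le_of_forall_lt_succ_of_le {t : ℕ → ℝ} {n : ℕ} (h : ∀ j < n, t j < t (j + 1))
    {i k : ℕ} (hik : i ≤ k) (hk : k ≤ n) : t i ≤ t k := by
  induction k, hik using Nat.le_induction with
  | base => exact le_rfl
  | succ k _ ih => exact (ih (by omega)).trans (h k (by omega)).le

/-- The consecutive increments of a real sequence telescope. -/
lemma sum_Ico_one_sub_pred (t : ℕ → ℝ) (n : ℕ) :
    ∑ j ∈ Finset.Ico 1 n, (t j - t (j - 1)) = t (n - 1) - t 0 := by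
  rw [Finset.sum_Ico_eq_sum_range, ← Finset.sum_range_sub]
  refine Finset.sum_congr rfl fun j _ => ?_
  rw [Nat.add_comm 1 j, Nat.add_sub_cancel]

/-- Let `H ∈ (1/3,1/2]`, `T > 0`, `α ∈ (1−2H, H)`, `c_x > 0`, and let
`x : [0,T]² → ℝ` satisfy `|x(s,t)| ≤ c_x (t−s)^α` for `0 ≤ s ≤ t ≤ T`. Then for every
dissection `0 = t_0 < ⋯ < t_n = T`,
`|Σ_{j=1}^{n−1} x(t_{j−1},t_j) (1/2)((t_{j+1}−t_{j−1})^{2H} − (t_{j+1}−t_j)^{2H}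
 − (t_j−t_{j−1})^{2H})| ≤ 2 c_x T max_{1≤j≤n} (t_j − t_{j−1})^{α+2H−1}`. -/
theorem stmt2 (H T α cx : ℝ) (hH1 : 1/3 < H) (hH2 : H ≤ 1/2) (hT : 0 < T)
    (hα1 : 1 - 2*H < α) (hα2 : α < H) (hcx : 0 < cx)
    (x : ℝ → ℝ → ℝ)
    (hx1 : ∀ s t : ℝ, 0 ≤ s → s ≤ t → t ≤ T → |x s t| ≤ cx * (t - s) ^ α)
    (n : ℕ) (t : ℕ → ℝ) (hn : 1 ≤ n) (ht0 : t 0 = 0) (htn : t n = T)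
    (hmono : ∀ j < n, t j < t (j+1)) :
    |∑ j ∈ Finset.Ico 1 n, x (t (j-1)) (t j) *
        ((1/2) * ((t (j+1) - t (j-1)) ^ (2*H) - (t (j+1) - t j) ^ (2*H)
          - (t j - t (j-1)) ^ (2*H)))| ≤
      2 * cx * T *
        (Finset.Icc 1 n).sup' (Finset.nonempty_Icc.mpr hn)
          (fun j => (t j - t (j-1)) ^ (α + 2*H - 1)) := by
  set M := (Finset.Icc 1 n).sup' (Finset.nonempty_Icc.mpr hn)
    (fun j => (t j - t (j-1)) ^ (α + 2*H - 1)) with hM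
  have hle : ∀ j ∈ Finset.Icc 1 n, (t j - t (j-1)) ^ (α + 2*H - 1) ≤ M := fun j hj =>
    Finset.le_sup' (fun j => (t j - t (j-1)) ^ (α + 2*H - 1)) hj
  have hM0 : 0 ≤ M := by
    refine le_trans (Real.rpow_nonneg ?_ _) (hle 1 (Finset.mem_Icc.mpr ⟨le_rfl, hn⟩))
    exact sub_nonneg.mpr (le_of_forall_lt_succ_of_le hmono (Nat.sub_le 1 1) hn)
  have hterm : ∀ j ∈ Finset.Ico 1 n, |x (t (j-1)) (t j) *
      ((1/2) * ((t (j+1) - t (j-1)) ^ (2*H) - (t (j+1) - t j) ^ (2*H)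
        - (t j - t (j-1)) ^ (2*H)))| ≤ cx / 2 * M * (t j - t (j-1)) := by
    intro j hj
    obtain ⟨hj1, hjn⟩ := Finset.mem_Ico.mp hj
    have hs0 : 0 ≤ t (j-1) := ht0 ▸ le_of_forall_lt_succ_of_le hmono (Nat.zero_le _) (by omega)
    have htT : t j ≤ T := htn ▸ le_of_forall_lt_succ_of_le hmono hjn.le le_rfl
    have ha : 0 < t j - t (j-1) := by
      have := hmono (j-1) (by omega)
      rw [Nat.sub_add_cancel hj1] at this
      exact sub_pos.mpr this
    have hb : 0 < t (j+1) - t j := sub_pos.mpr (hmono j hjn)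
    have hx := hx1 (t (j-1)) (t j) hs0 (sub_pos.mp ha).le htT
    have hR := abs_add_rpow_sub_rpow_sub_rpow_le (p := 2*H) (by linarith) (by linarith)
      ha.le hb.le
    have hMj := hle j (Finset.mem_Icc.mpr ⟨hj1, hjn.le⟩)
    rw [show t j - t (j-1) + (t (j+1) - t j) = t (j+1) - t (j-1) by ring] at hR
    rw [abs_mul, abs_mul, abs_of_pos (by norm_num : (0:ℝ) < 1/2)]
    set a := t j - t (j-1)
    have hpow : a ^ α * a ^ (2*H) = a ^ (α + 2*H - 1) * a := by
      rw [← Real.rpow_add ha, ← Real.rpow_add_one ha.ne', sub_add_cancel]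
    calc _ ≤ cx * a ^ α * (1/2 * a ^ (2*H)) := by gcongr
      _ = cx / 2 * (a ^ α * a ^ (2*H)) := by ring
      _ = cx / 2 * a ^ (α + 2*H - 1) * a := by rw [hpow]; ring
      _ ≤ cx / 2 * M * a := by gcongr
  have htn1 : t (n-1) ≤ T := htn ▸ le_of_forall_lt_succ_of_le hmono (Nat.sub_le n 1) le_rfl
  calc _ ≤ ∑ j ∈ Finset.Ico 1 n, cx / 2 * M * (t j - t (j-1)) :=
        (Finset.abs_sum_le_sum_abs _ _).trans (Finset.sum_le_sum hterm)
    _ = cx / 2 * M * t (n-1) := by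
        rw [← Finset.mul_sum, sum_Ico_one_sub_pred, ht0, sub_zero]
    _ ≤ cx / 2 * M * T := by gcongr
    _ ≤ 2 * cx * T * M := by
        have : 0 ≤ cx * T * M := by positivity
        linarith
end

section
/- Let T > 0, θ₀ ∈ ℝ, α ∈ (0,1], X : [0,T] → ℝ be α-Hölder continuous with constant ‖X‖_{α,T}, ψ : ℝ → ℝ continuous and bounded, and φ : ℝ → ℝ continuously differentiable with φ and φ' bounded. Set 𝔠₂ = |θ₀| e^{|θ₀| ‖ψ‖_∞ T} and 𝔠₃ = max( 𝔠₂ ‖φ‖_∞ ‖ψ‖_∞ , ‖φ'‖_∞ (1 + e^{|θ₀| ‖ψ‖_∞ T}) + 𝔠₂ ‖φ‖_∞ ‖ψ‖_∞ T^{1−α} ). Then for all 0 ≤ s < t ≤ T and 0 ≤ u < v ≤ T, |L(s,t) − L(u,v)| ≤ 𝔠₃ (max(1, ‖X‖_{α,T})) (|t−v|^α + |s−u|), where L(s,t) = φ(X_t)(exp(θ₀ ∫_s^t ψ(X_r) dr) − 1). -/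
open Real intervalIntegral

theorem continuousOn_of_abs_sub_le_rpow {X : ℝ → ℝ} {S : Set ℝ} {C α : ℝ} (hα : 0 < α)
    (hX : ∀ s ∈ S, ∀ t ∈ S, |X t - X s| ≤ C * |t - s| ^ α) : ContinuousOn X S := by
  intro x hx
  have hc : Continuous fun y : ℝ => C * |y - x| ^ α :=
    continuous_const.mul
      ((continuous_abs.comp (continuous_id.sub continuous_const)).rpow_const fun _ => Or.inr hα.le)
  have h0 : Filter.Tendsto (fun y : ℝ => C * |y - x| ^ α) (nhdsWithin x S) (nhds 0) := by
    have h := (hc.tendsto x).mono_left (nhdsWithin_le_nhds (s := S))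
    simpa [Real.zero_rpow hα.ne'] using h
  rw [ContinuousWithinAt, tendsto_iff_dist_tendsto_zero]
  refine squeeze_zero' (Filter.Eventually.of_forall fun _ => dist_nonneg) ?_ h0
  filter_upwards [self_mem_nhdsWithin] with y hy
  simpa only [Real.dist_eq] using hX x hx y hy

theorem abs_exp_sub_exp_le {a b M : ℝ} (ha : a ≤ M) (hb : b ≤ M) :
    |Real.exp a - Real.exp b| ≤ Real.exp M * |a - b| := by
  have key : ∀ {x y : ℝ}, x ≤ M → Real.exp x - Real.exp y ≤ Real.exp M * |x - y| := by
    intro x y hx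
    calc Real.exp x - Real.exp y = Real.exp x * (1 - Real.exp (y - x)) := by
          rw [mul_sub, ← Real.exp_add]; ring_nf
      _ ≤ Real.exp x * |x - y| := by
          gcongr
          linarith [Real.add_one_le_exp (y - x), le_abs_self (x - y)]
      _ ≤ Real.exp M * |x - y| := by gcongr
  rw [abs_le]
  have h := key (x := b) (y := a) hb
  rw [abs_sub_comm] at h
  exact ⟨by linarith, key ha⟩

theorem abs_sub_le_of_abs_hasDerivAt_le {φ φ' : ℝ → ℝ} {K : ℝ}
    (hφ : ∀ y, HasDerivAt φ (φ' y) y) (hK : ∀ y, |φ' y| ≤ K) (x y : ℝ) :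
    |φ x - φ y| ≤ K * |x - y| :=
  convex_univ.norm_image_sub_le_of_norm_hasDerivWithin_le
    (fun z _ => (hφ z).hasDerivWithinAt) (fun z _ => hK z) (Set.mem_univ y) (Set.mem_univ x)

theorem abs_integral_le_of_abs_le {f : ℝ → ℝ} {K : ℝ} (hK : ∀ r, |f r| ≤ K) (a b : ℝ) :
    |∫ r in a..b, f r| ≤ K * |b - a| := by
  rw [← Real.norm_eq_abs]
  exact norm_integral_le_of_norm_le_const fun r _ => hK r

theorem abs_integral_sub_integral_le {f : ℝ → ℝ} {T K s t u v : ℝ}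
    (hf : ContinuousOn f (Set.Icc 0 T)) (hK : ∀ r, |f r| ≤ K)
    (hs : s ∈ Set.Icc 0 T) (ht : t ∈ Set.Icc 0 T) (hu : u ∈ Set.Icc 0 T) (hv : v ∈ Set.Icc 0 T) :
    |(∫ r in s..t, f r) - ∫ r in u..v, f r| ≤ K * (|t - v| + |s - u|) := by
  have hi : ∀ {a b : ℝ}, a ∈ Set.Icc 0 T → b ∈ Set.Icc 0 T →
      IntervalIntegrable f MeasureTheory.volume a b := fun ha hb =>
    (hf.mono (Set.uIcc_subset_Icc ha hb)).intervalIntegrable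
  have h : (∫ r in s..t, f r) - ∫ r in u..v, f r = (∫ r in v..t, f r) - ∫ r in u..s, f r := by
    linarith [integral_add_adjacent_intervals (hi hu hs) (hi hs ht),
      integral_add_adjacent_intervals (hi hu hv) (hi hv ht)]
  rw [h, mul_add]
  exact (abs_sub _ _).trans
    (add_le_add (abs_integral_le_of_abs_le hK v t) (abs_integral_le_of_abs_le hK u s))

theorem mul_integral_le_of_abs_le {f : ℝ → ℝ} {T K a b θ : ℝ} (hK : ∀ r, |f r| ≤ K)
    (ha : 0 ≤ a) (hab : a ≤ b) (hb : b ≤ T) :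
    θ * ∫ r in a..b, f r ≤ |θ| * K * T := by
  have hK0 : 0 ≤ K := (abs_nonneg _).trans (hK 0)
  have hI := abs_integral_le_of_abs_le hK a b
  rw [abs_of_nonneg (sub_nonneg.2 hab)] at hI
  calc θ * ∫ r in a..b, f r ≤ |θ| * |∫ r in a..b, f r| := by
        rw [← abs_mul]; exact le_abs_self _
    _ ≤ |θ| * (K * T) := by
        gcongr
        exact hI.trans (by gcongr; linarith)
    _ = |θ| * K * T := by ring

/-- Let `T > 0`, `θ₀ ∈ ℝ`, `α ∈ (0,1]`, `X : [0,T] → ℝ` be `α`-Hölder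
continuous with constant `C_X = ‖X‖_{α,T}`, `ψ : ℝ → ℝ` continuous and bounded (by `Kψ`),
and `φ : ℝ → ℝ` continuously differentiable with `φ`, `φ'` bounded (by `Kφ`, `Kφ'`). Set
`𝔠₂ = |θ₀| e^{|θ₀| Kψ T}` and
`𝔠₃ = max(𝔠₂ Kφ Kψ, Kφ'(1 + e^{|θ₀| Kψ T}) + 𝔠₂ Kφ Kψ T^{1−α})`. Then for all
`0 ≤ s < t ≤ T` and `0 ≤ u < v ≤ T`,
`|L(s,t) − L(u,v)| ≤ 𝔠₃ max(1, C_X)(|t−v|^α + |s−u|)`, where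
`L(s,t) = φ(X_t)(exp(θ₀ ∫_s^t ψ(X_r) dr) − 1)`. -/
theorem stmt7 (T θ₀ α CX Kφ Kφ' Kψ : ℝ) (hT : 0 < T) (hα1 : 0 < α) (hα2 : α ≤ 1)
    (X : ℝ → ℝ)
    (hX : ∀ s ∈ Set.Icc (0:ℝ) T, ∀ t ∈ Set.Icc (0:ℝ) T, |X t - X s| ≤ CX * |t - s| ^ α)
    (ψ : ℝ → ℝ) (hψc : Continuous ψ) (hψb : ∀ y : ℝ, |ψ y| ≤ Kψ)
    (φ φ' : ℝ → ℝ) (hφd : ∀ y : ℝ, HasDerivAt φ (φ' y) y) (hφ'c : Continuous φ')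
    (hφb : ∀ y : ℝ, |φ y| ≤ Kφ) (hφ'b : ∀ y : ℝ, |φ' y| ≤ Kφ')
    (s t u v : ℝ) (hs : 0 ≤ s) (hst : s < t) (ht : t ≤ T)
    (hu : 0 ≤ u) (huv : u < v) (hv : v ≤ T) :
    |φ (X t) * (Real.exp (θ₀ * ∫ r in s..t, ψ (X r)) - 1)
        - φ (X v) * (Real.exp (θ₀ * ∫ r in u..v, ψ (X r)) - 1)| ≤
      max (|θ₀| * Real.exp (|θ₀| * Kψ * T) * Kφ * Kψ)
          (Kφ' * (1 + Real.exp (|θ₀| * Kψ * T))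
            + |θ₀| * Real.exp (|θ₀| * Kψ * T) * Kφ * Kψ * T ^ (1 - α))
        * max 1 CX * (|t - v| ^ α + |s - u|) := by
  have hKφ : 0 ≤ Kφ := (abs_nonneg _).trans (hφb 0)
  have hKφ' : 0 ≤ Kφ' := (abs_nonneg _).trans (hφ'b 0)
  have hKψ : 0 ≤ Kψ := (abs_nonneg _).trans (hψb 0)
  have hsT : s ∈ Set.Icc (0:ℝ) T := ⟨hs, by linarith⟩
  have htT : t ∈ Set.Icc (0:ℝ) T := ⟨by linarith, ht⟩
  have huT : u ∈ Set.Icc (0:ℝ) T := ⟨hu, by linarith⟩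
  have hvT : v ∈ Set.Icc (0:ℝ) T := ⟨by linarith, hv⟩
  have hI := abs_integral_sub_integral_le
    (hψc.comp_continuousOn (continuousOn_of_abs_sub_le_rpow hα1 hX))
    (fun r => hψb (X r)) hsT htT huT hvT
  have ha := mul_integral_le_of_abs_le (θ := θ₀) (fun r => hψb (X r)) hs hst.le ht
  have hb := mul_integral_le_of_abs_le (θ := θ₀) (fun r => hψb (X r)) hu huv.le hv
  simp only [Function.comp_apply] at hI
  set I := ∫ r in s..t, ψ (X r)
  set J := ∫ r in u..v, ψ (X r)
  set E := Real.exp (|θ₀| * Kψ * T)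
  have hE : 0 < E := Real.exp_pos _
  set A := |t - v| ^ α
  have hA : 0 ≤ A := by positivity
  set c := |θ₀| * E * Kφ * Kψ with hc
  have hc0 : 0 ≤ c := by positivity
  have hexp : |Real.exp (θ₀ * I) - Real.exp (θ₀ * J)| ≤
      |θ₀| * E * Kψ * (|t - v| + |s - u|) :=
    calc |Real.exp (θ₀ * I) - Real.exp (θ₀ * J)| ≤ E * |θ₀ * I - θ₀ * J| :=
          abs_exp_sub_exp_le ha hb
      _ = |θ₀| * E * |I - J| := by rw [← mul_sub, abs_mul]; ring
      _ ≤ |θ₀| * E * (Kψ * (|t - v| + |s - u|)) := by gcongr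
      _ = _ := by ring
  have hone : |Real.exp (θ₀ * J) - 1| ≤ 1 + E := by
    have h1 : Real.exp (θ₀ * J) ≤ E := Real.exp_le_exp.2 hb
    have h2 := Real.exp_pos (θ₀ * J)
    rw [abs_le]
    constructor <;> linarith
  have hφX : |φ (X t) - φ (X v)| ≤ Kφ' * (max 1 CX * A) :=
    (abs_sub_le_of_abs_hasDerivAt_le hφd hφ'b _ _).trans <| by
      gcongr
      exact (hX v hvT t htT).trans (by gcongr; exact le_max_right _ _)
  have htv : |t - v| ≤ T ^ (1 - α) * A := by
    have hle : |t - v| ≤ T := by rw [abs_le]; constructor <;> linarith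
    have h1 : |t - v| = |t - v| ^ (1 - α) * A := by
      rw [← Real.rpow_add_of_nonneg (abs_nonneg _) (by linarith) hα1.le]
      simp
    calc |t - v| = |t - v| ^ (1 - α) * A := h1
      _ ≤ T ^ (1 - α) * A := by
        gcongr
  set B := T ^ (1 - α)
  set m := max 1 CX
  have hm : 1 ≤ m := le_max_left _ _
  calc |φ (X t) * (Real.exp (θ₀ * I) - 1) - φ (X v) * (Real.exp (θ₀ * J) - 1)|
      = |φ (X t) * (Real.exp (θ₀ * I) - Real.exp (θ₀ * J))
          + (φ (X t) - φ (X v)) * (Real.exp (θ₀ * J) - 1)| := by ring_nf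
    _ ≤ |φ (X t)| * |Real.exp (θ₀ * I) - Real.exp (θ₀ * J)|
          + |φ (X t) - φ (X v)| * |Real.exp (θ₀ * J) - 1| := by
        rw [← abs_mul, ← abs_mul]; exact abs_add_le _ _
    _ ≤ Kφ * (|θ₀| * E * Kψ * (|t - v| + |s - u|)) + Kφ' * (m * A) * (1 + E) := by
        gcongr
        exact hφb _
    _ = c * |t - v| + c * |s - u| + Kφ' * (1 + E) * (m * A) := by rw [hc]; ring
    _ ≤ c * (m * (B * A)) + c * (m * |s - u|) + Kφ' * (1 + E) * (m * A) := by
        gcongr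
        · exact htv.trans (le_mul_of_one_le_left ((abs_nonneg _).trans htv) hm)
        · exact le_mul_of_one_le_left (abs_nonneg _) hm
    _ = c * (m * |s - u|) + (Kφ' * (1 + E) + c * B) * (m * A) := by ring
    _ ≤ max c (Kφ' * (1 + E) + c * B) * (m * |s - u|)
          + max c (Kφ' * (1 + E) + c * B) * (m * A) := by
        gcongr
        · exact le_max_left _ _
        · exact le_max_right _ _
    _ = max c (Kφ' * (1 + E) + c * B) * m * (A + |s - u|) := by ring
end

section
/- Let T > 0, θ₀ ∈ ℝ, p ≥ 1 and set α = 1/p. Let X : [0,T] → ℝ be α-Hölder continuous with constant ‖X‖_{α,T}, ψ : ℝ → ℝ continuous and bounded, and φ : ℝ → ℝ continuously differentiable with φ and φ' bounded. Set 𝔠₁ = |θ₀| ‖φ‖_∞ ‖ψ‖_∞ e^{|θ₀| ‖ψ‖_∞ T}, 𝔠₅ = |θ₀| ‖ψ‖_∞ e^{2|θ₀| ‖ψ‖_∞ T} and 𝔠₆ = 𝔠₅ T^{1−α} (𝔠₁ T^{1−α} + ‖φ'‖_∞). Then with L̄(s,t) = φ(X_t) exp(θ₀ ∫_s^t ψ(X_r)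 dr), for every pair of dissections 0 = s_0 ≤ ⋯ ≤ s_m = T and 0 = t_0 ≤ ⋯ ≤ t_n = T, Σ_{i=0}^{m−1} Σ_{j=0}^{n−1} |L̄(t_{j+1}, s_i) − L̄(t_j, s_i) − (L̄(t_{j+1}, s_{i+1}) − L̄(t_j, s_{i+1}))|^p ≤ 𝔠₆^p T² (max(1, ‖X‖_{α,T}))^p. -/
open Real intervalIntegral

/-- The points of a dissection of `[0, T]` lie in `[0, T]`. -/
theorem mem_Icc_of_dissection {T : ℝ} {m : ℕ} {s : ℕ → ℝ} (hs0 : s 0 = 0) (hsm : s m = T)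
    (hs : ∀ i < m, s i ≤ s (i + 1)) {i : ℕ} (hi : i ≤ m) : s i ∈ Set.Icc (0 : ℝ) T := by
  constructor
  · induction i with
    | zero => exact hs0.ge
    | succ k ih => exact (ih (by omega)).trans (hs k (by omega))
  · rw [← hsm]
    induction hi using Nat.decreasingInduction with
    | self => exact le_rfl
    | of_succ k hk ih => exact (hs k hk).trans ih

/-- On an interval of length at most `T`, a linear bound gives an `α`-Hölder bound, `α ≤ 1`. -/
theorem le_rpow_mul_rpow {T α h : ℝ} (hT : 0 < T) (hα1 : α ≤ 1) (h0 : 0 ≤ h)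
    (hh : h ≤ T) : h ≤ T ^ (1 - α) * h ^ α := by
  rcases h0.eq_or_lt with rfl | hpos
  · positivity
  calc h = h ^ (1 - α) * h ^ α := by rw [← Real.rpow_add hpos]; simp
    _ ≤ T ^ (1 - α) * h ^ α := by
      gcongr

/-- The rectangular increment of `f(u) exp(G(u) - G(v))` factorises, which bounds it by the product
of the increments of the two factors. -/
theorem abs_rectangular_increment_le {a b Kφ K M h k δ x x' y y' : ℝ}
    (hKφ : 0 ≤ Kφ) (ha : |b - a| ≤ δ) (hb : |b| ≤ Kφ)
    (hxx : |x' - x| ≤ K * h) (hyy : |y' - y| ≤ K * k) (hM : |x' - x| ≤ M)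
    (hxy : |x - y| ≤ M) (hxy' : |x - y'| ≤ M) :
    |a * Real.exp (x - y') - a * Real.exp (x - y)
        - (b * Real.exp (x' - y') - b * Real.exp (x' - y))|
      ≤ (Kφ * (Real.exp M * (K * h)) + δ) * (Real.exp M * (K * k)) := by
  have hM0 : 0 ≤ M := (abs_nonneg _).trans hM
  have e1 : ∀ z, Real.exp (x' - z) = Real.exp (x' - x) * Real.exp (x - z) := fun z => by
    rw [← Real.exp_add]; congr 1; ring
  have e2 : a * Real.exp (x - y') - a * Real.exp (x - y)
        - (b * Real.exp (x' - y') - b * Real.exp (x' - y))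
      = (-(b * (Real.exp (x' - x) - Real.exp 0)) - (b - a))
        * (Real.exp (x - y') - Real.exp (x - y)) := by
    rw [e1 y, e1 y', Real.exp_zero]; ring
  have h1 : |Real.exp (x' - x) - Real.exp 0| ≤ Real.exp M * (K * h) := by
    refine (abs_exp_sub_exp_le ((le_abs_self _).trans hM) hM0).trans ?_
    rw [sub_zero]
    gcongr
  have h2 : |Real.exp (x - y') - Real.exp (x - y)| ≤ Real.exp M * (K * k) := by
    refine (abs_exp_sub_exp_le ((le_abs_self _).trans hxy') ((le_abs_self _).trans hxy)).trans ?_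
    have : |x - y' - (x - y)| = |y' - y| := by rw [← abs_neg]; congr 1; ring
    rw [this]
    gcongr
  rw [e2, abs_mul]
  refine mul_le_mul ?_ h2 (abs_nonneg _) ?_
  · refine (abs_sub _ _).trans ?_
    rw [abs_neg, abs_mul]
    gcongr
  · have := (abs_nonneg _).trans h1
    have := (abs_nonneg _).trans ha
    positivity

/-- Let `T > 0`, `θ₀ ∈ ℝ`, `p ≥ 1`, `α = 1/p`, `X : [0,T] → ℝ` `α`-Hölder
continuous with constant `C_X`, `ψ : ℝ → ℝ` continuous and bounded (by `Kψ`), and `φ`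
continuously differentiable with `φ`, `φ'` bounded (by `Kφ`, `Kφ'`). With
`𝔠₁ = |θ₀| Kφ Kψ e^{|θ₀| Kψ T}`, `𝔠₅ = |θ₀| Kψ e^{2|θ₀| Kψ T}`,
`𝔠₆ = 𝔠₅ T^{1−α}(𝔠₁ T^{1−α} + Kφ')`, and `L̄(s,t) = φ(X_t) exp(θ₀ ∫_s^t ψ(X_r) dr)`,
for every pair of dissections `0 = s_0 ≤ ⋯ ≤ s_m = T` and `0 = t_0 ≤ ⋯ ≤ t_n = T`,
`Σ_{i<m} Σ_{j<n} |L̄(t_{j+1},s_i) − L̄(t_j,s_i) − (L̄(t_{j+1},s_{i+1}) − L̄(t_j,s_{i+1}))|^p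
  ≤ 𝔠₆^p T² max(1,C_X)^p`. -/
theorem stmt11 (T θ₀ p α CX Kφ Kφ' Kψ : ℝ) (hT : 0 < T) (hp : 1 ≤ p) (hα : α = 1/p)
    (X : ℝ → ℝ)
    (hX : ∀ s ∈ Set.Icc (0:ℝ) T, ∀ t ∈ Set.Icc (0:ℝ) T, |X t - X s| ≤ CX * |t - s| ^ α)
    (ψ : ℝ → ℝ) (hψc : Continuous ψ) (hψb : ∀ y : ℝ, |ψ y| ≤ Kψ)
    (φ φ' : ℝ → ℝ) (hφd : ∀ y : ℝ, HasDerivAt φ (φ' y) y) (hφ'c : Continuous φ')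
    (hφb : ∀ y : ℝ, |φ y| ≤ Kφ) (hφ'b : ∀ y : ℝ, |φ' y| ≤ Kφ')
    (m n : ℕ) (s t : ℕ → ℝ)
    (hs0 : s 0 = 0) (hsm : s m = T) (hsmono : ∀ i < m, s i ≤ s (i+1))
    (ht0 : t 0 = 0) (htn : t n = T) (htmono : ∀ j < n, t j ≤ t (j+1)) :
    (∑ i ∈ Finset.range m, ∑ j ∈ Finset.range n,
        |φ (X (s i)) * Real.exp (θ₀ * ∫ r in (t (j+1))..(s i), ψ (X r))
          - φ (X (s i)) * Real.exp (θ₀ * ∫ r in (t j)..(s i), ψ (X r))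
          - (φ (X (s (i+1))) * Real.exp (θ₀ * ∫ r in (t (j+1))..(s (i+1)), ψ (X r))
              - φ (X (s (i+1))) * Real.exp (θ₀ * ∫ r in (t j)..(s (i+1)), ψ (X r)))| ^ p) ≤
      ((|θ₀| * Kψ * Real.exp (2 * |θ₀| * Kψ * T)) * T ^ (1 - α)
          * ((|θ₀| * Kφ * Kψ * Real.exp (|θ₀| * Kψ * T)) * T ^ (1 - α) + Kφ')) ^ p
        * T ^ 2 * (max 1 CX) ^ p := by
  have hp0 : 0 < p := by linarith
  have hα0 : 0 < α := by rw [hα]; positivity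
  have hα1 : α ≤ 1 := by rw [hα, div_le_one hp0]; exact hp
  have hαp : α * p = 1 := by rw [hα]; field_simp
  have hKφ : 0 ≤ Kφ := (abs_nonneg _).trans (hφb 0)
  have hKφ' : 0 ≤ Kφ' := (abs_nonneg _).trans (hφ'b 0)
  have hKψ : 0 ≤ Kψ := (abs_nonneg _).trans (hψb 0)
  have hXc : ContinuousOn X (Set.Icc 0 T) := by
    intro u hu
    have hlim : Filter.Tendsto (fun v => CX * |v - u| ^ α) (nhdsWithin u (Set.Icc 0 T))
        (nhds 0) := by
      have hc : Continuous fun v : ℝ => CX * |v - u| ^ α :=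
        continuous_const.mul
          ((continuous_id.sub continuous_const).abs.rpow_const fun _ => Or.inr hα0.le)
      have := (hc.tendsto u).mono_left (nhdsWithin_le_nhds (s := Set.Icc 0 T))
      simpa [Real.zero_rpow hα0.ne'] using this
    refine tendsto_iff_dist_tendsto_zero.2 (squeeze_zero' (Filter.Eventually.of_forall
      fun _ => dist_nonneg) ?_ hlim)
    filter_upwards [self_mem_nhdsWithin] with v hv
    exact hX u hu v hv
  have hint : ∀ u ∈ Set.Icc (0 : ℝ) T, ∀ v ∈ Set.Icc (0 : ℝ) T,
      IntervalIntegrable (fun r => ψ (X r)) MeasureTheory.volume u v := fun u hu v hv =>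
    ((hψc.comp_continuousOn hXc).mono (Set.uIcc_subset_Icc hu hv)).intervalIntegrable
  have h0 : (0 : ℝ) ∈ Set.Icc 0 T := ⟨le_rfl, hT.le⟩
  set G : ℝ → ℝ := fun u => θ₀ * ∫ r in (0 : ℝ)..u, ψ (X r) with hG
  have hGsub : ∀ u ∈ Set.Icc (0 : ℝ) T, ∀ v ∈ Set.Icc (0 : ℝ) T,
      θ₀ * ∫ r in u..v, ψ (X r) = G v - G u := fun u hu v hv => by
    rw [hG]
    simp only
    rw [← mul_sub, integral_interval_sub_left (hint 0 h0 v hv) (hint 0 h0 u hu)]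
  have hGlip : ∀ u ∈ Set.Icc (0 : ℝ) T, ∀ v ∈ Set.Icc (0 : ℝ) T,
      |G v - G u| ≤ |θ₀| * Kψ * |v - u| := fun u hu v hv => by
    rw [← hGsub u hu v hv, abs_mul, mul_assoc]
    gcongr
    exact norm_integral_le_of_norm_le_const (f := fun r => ψ (X r)) fun r _ => hψb (X r)
  have hGT : ∀ u ∈ Set.Icc (0 : ℝ) T, ∀ v ∈ Set.Icc (0 : ℝ) T,
      |G v - G u| ≤ |θ₀| * Kψ * T := fun u hu v hv => by
    refine (hGlip u hu v hv).trans ?_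
    gcongr
    rw [abs_le]
    constructor <;> linarith [hu.1, hu.2, hv.1, hv.2]
  have hφlip : ∀ x y : ℝ, |φ y - φ x| ≤ Kφ' * |y - x| := fun x y =>
    Convex.norm_image_sub_le_of_norm_hasDerivWithin_le (f' := φ')
      (fun z _ => (hφd z).hasDerivWithinAt) (fun z _ => hφ'b z) convex_univ
      (Set.mem_univ x) (Set.mem_univ y)
  set K := |θ₀| * Kψ with hK
  have hK0 : 0 ≤ K := by positivity
  set c₆ := (|θ₀| * Kψ * Real.exp (2 * |θ₀| * Kψ * T)) * T ^ (1 - α)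
          * ((|θ₀| * Kφ * Kψ * Real.exp (|θ₀| * Kψ * T)) * T ^ (1 - α) + Kφ') with hc₆
  have hc₆0 : 0 ≤ c₆ := by positivity
  have hM0 : (0 : ℝ) ≤ max 1 CX := zero_le_one.trans (le_max_left _ _)
  have key : ∀ i ∈ Finset.range m, ∀ j ∈ Finset.range n,
      |φ (X (s i)) * Real.exp (θ₀ * ∫ r in (t (j+1))..(s i), ψ (X r))
          - φ (X (s i)) * Real.exp (θ₀ * ∫ r in (t j)..(s i), ψ (X r))
          - (φ (X (s (i+1))) * Real.exp (θ₀ * ∫ r in (t (j+1))..(s (i+1)), ψ (X r))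
              - φ (X (s (i+1))) * Real.exp (θ₀ * ∫ r in (t j)..(s (i+1)), ψ (X r)))| ^ p
        ≤ c₆ ^ p * max 1 CX ^ p * ((s (i+1) - s i) * (t (j+1) - t j)) := by
    intro i hi j hj
    rw [Finset.mem_range] at hi hj
    have hsi := mem_Icc_of_dissection hs0 hsm hsmono hi.le
    have hsi' := mem_Icc_of_dissection hs0 hsm hsmono (Nat.succ_le_of_lt hi)
    have htj := mem_Icc_of_dissection ht0 htn htmono hj.le
    have htj' := mem_Icc_of_dissection ht0 htn htmono (Nat.succ_le_of_lt hj)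
    rw [Nat.succ_eq_add_one] at hsi' htj'
    rw [hGsub _ htj' _ hsi, hGsub _ htj _ hsi, hGsub _ htj' _ hsi', hGsub _ htj _ hsi']
    have hh0 : 0 ≤ s (i+1) - s i := sub_nonneg.2 (hsmono i hi)
    have hk0 : 0 ≤ t (j+1) - t j := sub_nonneg.2 (htmono j hj)
    have hhT : s (i+1) - s i ≤ T := by linarith [hsi.1, hsi'.2]
    have hkT : t (j+1) - t j ≤ T := by linarith [htj.1, htj'.2]
    have hXi := hX _ hsi _ hsi'
    have hGs := hGlip _ hsi _ hsi'
    have hGt := hGlip _ htj _ htj'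
    rw [abs_of_nonneg hh0] at hXi hGs
    rw [abs_of_nonneg hk0] at hGt
    have hinc := abs_rectangular_increment_le hKφ
      ((hφlip _ _).trans (mul_le_mul_of_nonneg_left hXi hKφ')) (hφb (X (s (i+1))))
      hGs hGt (hGT _ hsi _ hsi') (hGT _ htj _ hsi) (hGT _ htj' _ hsi)
    have hh := le_rpow_mul_rpow hT hα1 hh0 hhT
    have hk := le_rpow_mul_rpow hT hα1 hk0 hkT
    set h := s (i+1) - s i
    set k := t (j+1) - t j
    have hE : Real.exp (K * T) ≤ Real.exp (2 * |θ₀| * Kψ * T) := by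
      apply Real.exp_le_exp.2
      have : 0 ≤ K * T := by positivity
      rw [hK] at this ⊢
      linarith
    have hbound : (Kφ * (Real.exp (K * T) * (K * h)) + Kφ' * (CX * h ^ α))
          * (Real.exp (K * T) * (K * k)) ≤ c₆ * max 1 CX * (h ^ α * k ^ α) := by
      calc _ ≤ (Kφ * (Real.exp (K * T) * (K * (T ^ (1 - α) * h ^ α))) * max 1 CX
              + Kφ' * (max 1 CX * h ^ α))
            * (Real.exp (2 * |θ₀| * Kψ * T) * (K * (T ^ (1 - α) * k ^ α))) := by
            refine mul_le_mul (add_le_add ?_ ?_) ?_ (by positivity) (by positivity)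
            · refine le_trans ?_ (le_mul_of_one_le_right (by positivity) (le_max_left _ _))
              gcongr
            · gcongr
              exact le_max_right _ _
            · gcongr
        _ = _ := by rw [hc₆, hK]; ring
    calc _ ≤ (c₆ * max 1 CX * (h ^ α * k ^ α)) ^ p :=
          Real.rpow_le_rpow (abs_nonneg _) (hinc.trans hbound) hp0.le
      _ = _ := by
          rw [Real.mul_rpow (by positivity) (by positivity), Real.mul_rpow hc₆0 hM0,
            Real.mul_rpow (x := h ^ α) (by positivity) (by positivity), ← Real.rpow_mul hh0,
            ← Real.rpow_mul hk0, hαp, Real.rpow_one, Real.rpow_one]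
  refine (Finset.sum_le_sum fun i hi => Finset.sum_le_sum (key i hi)).trans (le_of_eq ?_)
  simp_rw [← Finset.mul_sum]
  rw [← Finset.sum_mul, Finset.sum_range_sub, Finset.sum_range_sub, hsm, hs0, htn, ht0]
  ring
end

section
/- Let H ∈ (1/2, 1), T > 0, N ≥ 1, and let X^1, …, X^N : [0,T] → ℝ be continuous. Let φ, ψ : ℝ → ℝ be continuous and bounded with φ ≤ 0 and ψ ≤ 0, and sup-norms ‖φ‖_∞, ‖ψ‖_∞. Let D_N > 0 and I_N be real numbers, c ∈ (0,1), and set α_H = H(2H−1), ᾱ_H = α_H / (2H(2H+1)) and M_N = exp(‖ψ‖_∞ |I_N| T). Assume ᾱ_H ‖φ‖_∞ ‖ψ‖_∞ T^{2H} M_N ≤ c D_N. Define, for r ≥ 0, Θ_N(r) = −(α_H / (N T D_N)) Σ_{i=1}^N ∫_0^T ∫_0^t φ(X_t^i) exp( (r + I_N) ∫_s^t ψ(X_u^i) du ) (t−s)^{2H−2} ds dt. Then Θ_N(r) ≥ 0 for every r ≥ 0, |Θ_N(r̄) − Θ_N(r)| ≤ c |r̄ − r| for all r, r̄ ≥ 0,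 and Θ_N admits a unique fixed point in [0, ∞). -/
open Real intervalIntegral

section SingularVolterraKernel

open MeasureTheory Set

variable {g : ℝ → ℝ → ℝ} {B q T : ℝ}

lemma integral_sub_left_rpow (hq : -1 < q) (u : ℝ) :
    ∫ s in (0:ℝ)..u, (u - s) ^ q = u ^ (q + 1) / (q + 1) := by
  rw [intervalIntegral.integral_comp_sub_left (fun x => x ^ q), sub_self, sub_zero,
    integral_rpow (Or.inl hq), Real.zero_rpow (by linarith), sub_zero]

lemma intervalIntegrable_sub_left_rpow (hq : -1 < q) (u : ℝ) :
    IntervalIntegrable (fun s => (u - s) ^ q) volume 0 u := by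
  have h := (intervalIntegrable_rpow' (a := u) (b := 0) hq).comp_sub_left u
  simpa using h

lemma intervalIntegrable_of_le_sub_rpow (hg : Measurable (Function.uncurry g)) (hq : -1 < q)
    {u : ℝ} (hu : 0 ≤ u) (hb : ∀ s ∈ Icc 0 u, |g u s| ≤ B * (u - s) ^ q) :
    IntervalIntegrable (g u) volume 0 u := by
  refine ((intervalIntegrable_sub_left_rpow hq u).const_mul B).mono_fun'
    hg.of_uncurry_left.aestronglyMeasurable ?_
  refine (ae_restrict_iff' measurableSet_uIoc).2 (Filter.Eventually.of_forall fun s hs => ?_)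
  rw [uIoc_of_le hu] at hs
  exact hb s ⟨hs.1.le, hs.2⟩

lemma abs_integral_le_of_le_sub_rpow (hq : -1 < q)
    {u : ℝ} (hu : 0 ≤ u) (hb : ∀ s ∈ Icc 0 u, |g u s| ≤ B * (u - s) ^ q) :
    |∫ s in (0:ℝ)..u, g u s| ≤ B * (u ^ (q + 1) / (q + 1)) := by
  rw [← integral_sub_left_rpow hq, ← intervalIntegral.integral_const_mul, ← Real.norm_eq_abs]
  exact intervalIntegral.norm_integral_le_of_norm_le hu
    (Filter.Eventually.of_forall fun s hs => hb s ⟨hs.1.le, hs.2⟩)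
    ((intervalIntegrable_sub_left_rpow hq u).const_mul B)

lemma intervalIntegrable_integral_of_le_sub_rpow (hg : Measurable (Function.uncurry g))
    (hq : -1 < q) (hT : 0 ≤ T)
    (hb : ∀ u ∈ Icc 0 T, ∀ s ∈ Icc 0 u, |g u s| ≤ B * (u - s) ^ q) :
    IntervalIntegrable (fun u => ∫ s in (0:ℝ)..u, g u s) volume 0 T := by
  have hmeas : StronglyMeasurable fun u : ℝ =>
      ∫ s, {z : ℝ × ℝ | 0 < z.2 ∧ z.2 ≤ z.1}.indicator (Function.uncurry g) (u, s) := by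
    have hs : MeasurableSet {z : ℝ × ℝ | 0 < z.2 ∧ z.2 ≤ z.1} :=
      (measurableSet_lt measurable_const measurable_snd).inter
        (measurableSet_le measurable_snd measurable_fst)
    exact (hg.indicator hs).stronglyMeasurable.integral_prod_right'
  have hdom : IntervalIntegrable (fun u : ℝ => B * (u ^ (q + 1) / (q + 1))) volume 0 T :=
    ((intervalIntegrable_rpow' (by linarith)).div_const _).const_mul B
  refine hdom.mono_fun' (hmeas.aestronglyMeasurable.congr ?_) ?_ <;>
    refine (ae_restrict_iff' measurableSet_uIoc).2 (Filter.Eventually.of_forall fun u hu => ?_) <;>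
    rw [uIoc_of_le hT] at hu
  · simp only
    rw [intervalIntegral.integral_of_le hu.1.le,
      ← MeasureTheory.integral_indicator measurableSet_Ioc]
    rfl
  · exact abs_integral_le_of_le_sub_rpow hq hu.1.le (hb u ⟨hu.1.le, hu.2⟩)

lemma abs_integral_integral_le_of_le_sub_rpow (hq : -1 < q) (hT : 0 ≤ T)
    (hb : ∀ u ∈ Icc 0 T, ∀ s ∈ Icc 0 u, |g u s| ≤ B * (u - s) ^ q) :
    |∫ u in (0:ℝ)..T, ∫ s in (0:ℝ)..u, g u s| ≤ B * (T ^ (q + 2) / ((q + 1) * (q + 2))) := by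
  have hint : ∫ u in (0:ℝ)..T, B * (u ^ (q + 1) / (q + 1)) =
      B * (T ^ (q + 2) / ((q + 1) * (q + 2))) := by
    rw [intervalIntegral.integral_const_mul, intervalIntegral.integral_div,
      integral_rpow (Or.inl (by linarith)), Real.zero_rpow (by linarith), sub_zero, div_div,
      show q + 1 + 1 = q + 2 by ring, mul_comm (q + 2)]
  rw [← hint, ← Real.norm_eq_abs]
  exact intervalIntegral.norm_integral_le_of_norm_le hT
    (Filter.Eventually.of_forall fun u hu =>
      abs_integral_le_of_le_sub_rpow hq hu.1.le (hb u ⟨hu.1.le, hu.2⟩))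
    (((intervalIntegrable_rpow' (r := q + 1) (by linarith)).div_const _).const_mul B)

end SingularVolterraKernel

lemma abs_exp_mul_sub_exp_mul_le {a b A C : ℝ} (ha : Real.exp (a * A) ≤ C)
    (hb : Real.exp (b * A) ≤ C) :
    |Real.exp (b * A) - Real.exp (a * A)| ≤ C * |A| * |b - a| := by
  have h1 := Real.add_one_le_exp (b * A - a * A)
  have h2 := Real.add_one_le_exp (a * A - b * A)
  rw [Real.exp_sub, le_div_iff₀ (Real.exp_pos _)] at h1 h2
  have h3 : |A| * |b - a| = |b * A - a * A| := by rw [← abs_mul]; ring_nf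
  have h4 := le_abs_self (b * A - a * A)
  have h5 := neg_abs_le (b * A - a * A)
  have h6 := mul_le_mul_of_nonneg_right hb (abs_nonneg (b * A - a * A))
  have h7 := mul_le_mul_of_nonneg_right ha (abs_nonneg (b * A - a * A))
  rw [mul_assoc, h3, abs_le]
  constructor
  · nlinarith [mul_le_mul_of_nonneg_left h5 (Real.exp_pos (a * A)).le]
  · nlinarith [mul_le_mul_of_nonneg_left h4 (Real.exp_pos (b * A)).le]

/-- For continuous coefficients, the singular Volterra double integral is Lipschitz in the
exponential parameter. -/
lemma abs_integral_exp_kernel_sub_le {H T I Kφ Kψ r r' : ℝ} (hH1 : 1 / 2 < H) (hT : 0 < T)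
    {a b : ℝ → ℝ} (ha : ContinuousOn a (Set.Icc 0 T)) (hb : ContinuousOn b (Set.Icc 0 T))
    (haK : ∀ t ∈ Set.Icc 0 T, |a t| ≤ Kφ) (hb0 : ∀ t ∈ Set.Icc 0 T, b t ≤ 0)
    (hbK : ∀ t ∈ Set.Icc 0 T, |b t| ≤ Kψ) (hr : 0 ≤ r) (hr' : 0 ≤ r') :
    |(∫ u in (0:ℝ)..T, ∫ s in (0:ℝ)..u,
          a u * Real.exp ((r' + I) * ∫ w in s..u, b w) * (u - s) ^ (2 * H - 2)) -
        ∫ u in (0:ℝ)..T, ∫ s in (0:ℝ)..u,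
          a u * Real.exp ((r + I) * ∫ w in s..u, b w) * (u - s) ^ (2 * H - 2)| ≤
      Kφ * Kψ * Real.exp (Kψ * |I| * T) * |r' - r| *
        (T ^ (2 * H + 1) / (2 * H * (2 * H + 1))) := by
  obtain ⟨a', ha'c, ha'⟩ : ∃ a' : ℝ → ℝ, Continuous a' ∧ ∀ t ∈ Set.Icc 0 T, a' t = a t :=
    ⟨Set.IccExtend hT.le ((Set.Icc 0 T).domRestrict a), ha.domRestrict.Icc_extend',
      fun t ht => Set.IccExtend_of_mem _ _ ht⟩
  obtain ⟨b', hb'c, hb'⟩ : ∃ b' : ℝ → ℝ, Continuous b' ∧ ∀ t ∈ Set.Icc 0 T, b' t = b t :=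
    ⟨Set.IccExtend hT.le ((Set.Icc 0 T).domRestrict b), hb.domRestrict.Icc_extend',
      fun t ht => Set.IccExtend_of_mem _ _ ht⟩
  set P : ℝ → ℝ := fun x => ∫ w in (0:ℝ)..x, b' w with hP
  have hPc : Continuous P :=
    intervalIntegral.continuous_primitive (fun _ _ => hb'c.intervalIntegrable _ _) 0
  have hK : 0 ≤ Kφ := (abs_nonneg _).trans (haK 0 ⟨le_rfl, hT.le⟩)
  have hKψ : 0 ≤ Kψ := (abs_nonneg _).trans (hbK 0 ⟨le_rfl, hT.le⟩)
  have hPsub : ∀ u ∈ Set.Icc 0 T, ∀ s ∈ Set.Icc 0 u, (∫ w in s..u, b w) = P u - P s := by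
    intro u hu s hs
    rw [hP, intervalIntegral.integral_interval_sub_left (hb'c.intervalIntegrable _ _)
      (hb'c.intervalIntegrable _ _)]
    refine intervalIntegral.integral_congr fun w hw => ?_
    rw [Set.uIcc_of_le hs.2] at hw
    exact (hb' w ⟨hs.1.trans hw.1, hw.2.trans hu.2⟩).symm
  have hPnonpos : ∀ u ∈ Set.Icc 0 T, ∀ s ∈ Set.Icc 0 u, P u - P s ≤ 0 := by
    intro u hu s hs
    rw [← hPsub u hu s hs, ← neg_nonneg, ← intervalIntegral.integral_neg]
    exact intervalIntegral.integral_nonneg hs.2 fun w hw =>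
      neg_nonneg.2 (hb0 w ⟨hs.1.trans hw.1, hw.2.trans hu.2⟩)
  have hPabs : ∀ u ∈ Set.Icc 0 T, ∀ s ∈ Set.Icc 0 u, |P u - P s| ≤ Kψ * (u - s) := by
    intro u hu s hs
    rw [← hPsub u hu s hs, ← abs_of_nonneg (sub_nonneg.2 hs.2), ← Real.norm_eq_abs]
    refine intervalIntegral.norm_integral_le_of_norm_le_const fun w hw => ?_
    rw [Set.uIoc_of_le hs.2] at hw
    exact hbK w ⟨hs.1.trans hw.1.le, hw.2.trans hu.2⟩
  have hexp : ∀ ρ : ℝ, 0 ≤ ρ → ∀ u ∈ Set.Icc 0 T, ∀ s ∈ Set.Icc 0 u,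
      Real.exp ((ρ + I) * (P u - P s)) ≤ Real.exp (Kψ * |I| * T) := by
    intro ρ hρ u hu s hs
    refine Real.exp_le_exp.2 ?_
    have h1 := mul_nonpos_of_nonneg_of_nonpos hρ (hPnonpos u hu s hs)
    have h2 : I * (P u - P s) ≤ |I| * |P u - P s| := by
      rw [← abs_mul]; exact le_abs_self _
    have h3 : |P u - P s| ≤ Kψ * T :=
      (hPabs u hu s hs).trans (mul_le_mul_of_nonneg_left (by linarith [hu.2, hs.1]) hKψ)
    nlinarith [mul_le_mul_of_nonneg_left h3 (abs_nonneg I)]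
  set G : ℝ → ℝ → ℝ → ℝ := fun ρ u s =>
    a' u * Real.exp ((ρ + I) * (P u - P s)) * (u - s) ^ (2 * H - 2) with hG
  have hGm : ∀ ρ, Measurable (Function.uncurry (G ρ)) := by
    intro ρ
    have := hPc.measurable
    have := ha'c.measurable
    simp only [hG, Function.uncurry_def]
    fun_prop
  have hGb : ∀ ρ, 0 ≤ ρ → ∀ u ∈ Set.Icc 0 T, ∀ s ∈ Set.Icc 0 u,
      |G ρ u s| ≤ (Kφ * Real.exp (Kψ * |I| * T)) * (u - s) ^ (2 * H - 2) := by
    intro ρ hρ u hu s hs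
    have hus := Real.rpow_nonneg (sub_nonneg.2 hs.2) (2 * H - 2)
    rw [hG, abs_mul, abs_mul, abs_of_nonneg hus, Real.abs_exp, ha' u hu]
    exact mul_le_mul_of_nonneg_right (mul_le_mul (haK u hu) (hexp ρ hρ u hu s hs)
      (Real.exp_pos _).le hK) hus
  have hGeq : ∀ ρ, (∫ u in (0:ℝ)..T, ∫ s in (0:ℝ)..u,
      a u * Real.exp ((ρ + I) * ∫ w in s..u, b w) * (u - s) ^ (2 * H - 2)) =
      ∫ u in (0:ℝ)..T, ∫ s in (0:ℝ)..u, G ρ u s := by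
    intro ρ
    refine intervalIntegral.integral_congr fun u hu => ?_
    rw [Set.uIcc_of_le hT.le] at hu
    refine intervalIntegral.integral_congr fun s hs => ?_
    rw [Set.uIcc_of_le hu.1] at hs
    simp only [hG, ha' u hu, hPsub u hu s hs]
  have hdiff : ∀ u ∈ Set.Icc 0 T, ∀ s ∈ Set.Icc 0 u, |G r' u s - G r u s| ≤
      (Kφ * Kψ * Real.exp (Kψ * |I| * T) * |r' - r|) * (u - s) ^ (2 * H - 1) := by
    intro u hu s hs
    have hd := sub_nonneg.2 hs.2
    have hus := Real.rpow_nonneg hd (2 * H - 2)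
    have hpow : (u - s) ^ (2 * H - 1) = (u - s) ^ (2 * H - 2) * (u - s) := by
      rw [← Real.rpow_add_one' hd (by linarith)]; ring_nf
    have hE := abs_exp_mul_sub_exp_mul_le (hexp r hr u hu s hs) (hexp r' hr' u hu s hs)
    rw [add_sub_add_right_eq_sub] at hE
    have hE' : |Real.exp ((r' + I) * (P u - P s)) - Real.exp ((r + I) * (P u - P s))| ≤
        Real.exp (Kψ * |I| * T) * (Kψ * (u - s)) * |r' - r| := by
      refine hE.trans ?_
      gcongr
      exact hPabs u hu s hs
    calc |G r' u s - G r u s|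
        = |a u| * |Real.exp ((r' + I) * (P u - P s)) - Real.exp ((r + I) * (P u - P s))| *
            (u - s) ^ (2 * H - 2) := by
          simp only [hG]
          rw [← sub_mul, ← mul_sub, abs_mul, abs_mul, abs_of_nonneg hus, ha' u hu]
      _ ≤ Kφ * (Real.exp (Kψ * |I| * T) * (Kψ * (u - s)) * |r' - r|) *
            (u - s) ^ (2 * H - 2) :=
          mul_le_mul_of_nonneg_right (mul_le_mul (haK u hu) hE' (abs_nonneg _) hK) hus
      _ = _ := by rw [hpow]; ring
  rw [hGeq, hGeq, ← intervalIntegral.integral_sub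
    (intervalIntegrable_integral_of_le_sub_rpow (hGm r') (by linarith) hT.le (hGb r' hr'))
    (intervalIntegrable_integral_of_le_sub_rpow (hGm r) (by linarith) hT.le (hGb r hr))]
  have hsub : (∫ u in (0:ℝ)..T, ((∫ s in (0:ℝ)..u, G r' u s) - ∫ s in (0:ℝ)..u, G r u s)) =
      ∫ u in (0:ℝ)..T, ∫ s in (0:ℝ)..u, (G r' u s - G r u s) := by
    refine intervalIntegral.integral_congr fun u hu => ?_
    rw [Set.uIcc_of_le hT.le] at hu
    exact (intervalIntegral.integral_sub
      (intervalIntegrable_of_le_sub_rpow (hGm r') (by linarith) hu.1 (hGb r' hr' u hu))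
      (intervalIntegrable_of_le_sub_rpow (hGm r) (by linarith) hu.1 (hGb r hr u hu))).symm
  rw [hsub]
  have h := abs_integral_integral_le_of_le_sub_rpow
    (g := fun u s => G r' u s - G r u s) (by linarith) hT.le hdiff
  rwa [show 2 * H - 1 + 2 = 2 * H + 1 by ring, show 2 * H - 1 + 1 = 2 * H by ring] at h

/-- Banach's fixed point theorem on the half-line `[0,∞)`. -/
lemma existsUnique_fixedPoint_of_abs_sub_le {f : ℝ → ℝ} {c : ℝ} (hc0 : 0 < c) (hc1 : c < 1)
    (hf0 : ∀ r, 0 ≤ r → 0 ≤ f r)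
    (hf : ∀ r r', 0 ≤ r → 0 ≤ r' → |f r' - f r| ≤ c * |r' - r|) :
    ∃! ρ : ℝ, 0 ≤ ρ ∧ f ρ = ρ := by
  have hmaps : Set.MapsTo f (Set.Ici 0) (Set.Ici 0) := fun r hr => hf0 r hr
  have hcontr : ContractingWith ⟨c, hc0.le⟩ (hmaps.restrict f _ _) :=
    ⟨by exact_mod_cast hc1, LipschitzWith.of_dist_le_mul fun x y => hf y x y.2 x.2⟩
  obtain ⟨ρ, hρ, hfix, -⟩ := hcontr.exists_fixedPoint' isClosed_Ici.isComplete hmaps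
    (Set.self_mem_Ici (a := (0:ℝ))) (edist_ne_top _ _)
  refine ⟨ρ, ⟨hρ, hfix⟩, fun σ ⟨hσ, hσfix⟩ => ?_⟩
  have h := hf ρ σ hρ hσ
  rw [hfix.eq, hσfix] at h
  have h0 : |σ - ρ| = 0 := by nlinarith [abs_nonneg (σ - ρ)]
  exact sub_eq_zero.1 (abs_eq_zero.1 h0)


/-- Let `H ∈ (1/2,1)`, `T > 0`, `N ≥ 1`, `X^1,…,X^N : [0,T] → ℝ`
continuous, `φ, ψ : ℝ → ℝ` continuous, bounded (by `Kφ`, `Kψ`, the sup-norms) and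
nonpositive, `D_N > 0`, `I_N ∈ ℝ`, `c ∈ (0,1)`, `α_H = H(2H−1)`,
`ᾱ_H = α_H/(2H(2H+1))`, `M_N = exp(Kψ |I_N| T)`. If
`ᾱ_H Kφ Kψ T^{2H} M_N ≤ c D_N`, then the map
`Θ_N(r) = −(α_H/(N T D_N)) Σ_i ∫_0^T ∫_0^t φ(X_t^i) exp((r+I_N) ∫_s^t ψ(X_u^i) du)
(t−s)^{2H−2} ds dt` is nonnegative on `[0,∞)`, `c`-Lipschitz on `[0,∞)`, and admits a
unique fixed point in `[0,∞)`. -/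
theorem stmt12 (H T D I c Kφ Kψ : ℝ) (N : ℕ)
    (hH1 : 1/2 < H) (hH2 : H < 1) (hT : 0 < T) (hN : 1 ≤ N)
    (X : ℕ → ℝ → ℝ) (hX : ∀ i, ContinuousOn (X i) (Set.Icc 0 T))
    (φ ψ : ℝ → ℝ) (hφc : Continuous φ) (hψc : Continuous ψ)
    (hφ0 : ∀ y : ℝ, φ y ≤ 0) (hψ0 : ∀ y : ℝ, ψ y ≤ 0)
    (hφb : ∀ y : ℝ, |φ y| ≤ Kφ) (hψb : ∀ y : ℝ, |ψ y| ≤ Kψ)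
    (hD : 0 < D) (hc1 : 0 < c) (hc2 : c < 1)
    (hcond : (H * (2*H - 1) / (2*H * (2*H + 1))) * Kφ * Kψ * T ^ (2*H)
        * Real.exp (Kψ * |I| * T) ≤ c * D) :
    let Θ : ℝ → ℝ := fun r =>
      -(H * (2*H - 1) / (N * T * D)) * ∑ i ∈ Finset.range N,
        ∫ u in (0:ℝ)..T, ∫ s in (0:ℝ)..u,
          φ (X i u) * Real.exp ((r + I) * ∫ w in s..u, ψ (X i w)) * (u - s) ^ (2*H - 2)
    (∀ r : ℝ, 0 ≤ r → 0 ≤ Θ r) ∧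
    (∀ r r' : ℝ, 0 ≤ r → 0 ≤ r' → |Θ r' - Θ r| ≤ c * |r' - r|) ∧
    (∃! ρ : ℝ, 0 ≤ ρ ∧ Θ ρ = ρ) := by
  intro Θ
  have hN' : (0:ℝ) < N := by exact_mod_cast hN
  have hα : 0 < H * (2 * H - 1) := mul_pos (by linarith) (by linarith)
  have hpre : 0 ≤ H * (2 * H - 1) / (N * T * D) := by positivity
  have hnonneg : ∀ r : ℝ, 0 ≤ r → 0 ≤ Θ r := by
    intro r _
    refine mul_nonneg_of_nonpos_of_nonpos (neg_nonpos.2 hpre) (Finset.sum_nonpos fun i _ => ?_)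
    rw [← neg_nonneg, ← intervalIntegral.integral_neg]
    refine intervalIntegral.integral_nonneg hT.le fun u hu => ?_
    rw [← intervalIntegral.integral_neg]
    refine intervalIntegral.integral_nonneg hu.1 fun s hs => neg_nonneg.2 ?_
    exact mul_nonpos_of_nonpos_of_nonneg
      (mul_nonpos_of_nonpos_of_nonneg (hφ0 _) (Real.exp_pos _).le)
      (Real.rpow_nonneg (sub_nonneg.2 hs.2) _)
  have hlip : ∀ r r' : ℝ, 0 ≤ r → 0 ≤ r' → |Θ r' - Θ r| ≤ c * |r' - r| := by
    intro r r' hr hr'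
    simp only [Θ]
    rw [← mul_sub, ← Finset.sum_sub_distrib, abs_mul, abs_neg, abs_of_nonneg hpre]
    have hsum := (Finset.abs_sum_le_sum_abs _ _).trans
      (Finset.sum_le_card_nsmul (Finset.range N) _ _ fun i _ =>
        abs_integral_exp_kernel_sub_le (I := I) (Kφ := Kφ) (Kψ := Kψ) hH1 hT
          (hφc.comp_continuousOn (hX i)) (hψc.comp_continuousOn (hX i))
          (fun t _ => hφb (X i t)) (fun t _ => hψ0 (X i t)) (fun t _ => hψb (X i t)) hr hr')
    rw [Finset.card_range, nsmul_eq_mul] at hsum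
    refine (mul_le_mul_of_nonneg_left hsum hpre).trans ?_
    have hT1 : T ^ (2 * H + 1) = T ^ (2 * H) * T := Real.rpow_add_one hT.ne' _
    have hH0 : 0 < H := by linarith
    calc _ = (H * (2*H - 1) / (2*H * (2*H + 1))) * Kφ * Kψ * T ^ (2*H)
        * Real.exp (Kψ * |I| * T) / D * |r' - r| := by
          rw [hT1]; field_simp
      _ ≤ c * |r' - r| :=
          mul_le_mul_of_nonneg_right ((div_le_iff₀ hD).2 hcond) (abs_nonneg _)
  exact ⟨hnonneg, hlip, existsUnique_fixedPoint_of_abs_sub_le hc1 hc2 hnonneg hlip⟩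
end

section
/- Let H ∈ (1/3, 1/2], T > 0, N ≥ 1, and let X^1, …, X^N : [0,T] → ℝ be continuous. Let φ, ψ : ℝ → ℝ be continuous and bounded with φ ≤ 0 and ψ ≤ 0, and sup-norms ‖φ‖_∞, ‖ψ‖_∞. Let D_N > 0 and I_N ≥ 0 be real numbers, c ∈ (0,1), and set α_H = H(2H−1), ᾱ_H = |α_H| / (2H(2H+1)) and M_N = exp(‖ψ‖_∞ |I_N| T). Assume ᾱ_H ‖φ‖_∞ ‖ψ‖_∞ T^{2H} M_N ≤ c D_N. Define, for r ≥ 0, Θ̃_N(r) = (1 / (N T D_N)) Σ_{i=1}^N ∫_0^T φ(X_t^i) [ −H t^{2H−1} + α_H ∫_0^t ( 1 − exp( (r + I_N) ∫_s^t ψ(X_u^i) du ) ) (t−s)^{2H−2} ds ] dt. Then Θ̃_N(r) ≥ 0 for every r ≥ 0, |Θ̃_N(r̄) − Θ̃_N(r)| ≤ c |r̄ − r| for all r, r̄ ≥ 0, and Θ̃_N admits a unique fixed point in [0, ∞). -/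
open Real intervalIntegral

theorem integral_mem_Icc_of_nonpos_of_abs_le {a : ℝ → ℝ} {K : ℝ}
    (ha0 : ∀ x, a x ≤ 0) (haK : ∀ x, |a x| ≤ K) {s u : ℝ} (hsu : s ≤ u) :
    (∫ w in s..u, a w) ≤ 0 ∧ -(∫ w in s..u, a w) ≤ K * (u - s) := by
  constructor
  · have := intervalIntegral.integral_nonneg (μ := MeasureTheory.volume) hsu
      (f := fun w => -a w) (fun x _ => by linarith [ha0 x])
    rw [intervalIntegral.integral_neg] at this
    linarith
  · have := intervalIntegral.norm_integral_le_of_norm_le_const (a := s) (b := u) (f := a) (C := K)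
      (fun x _ => haK x)
    rw [abs_of_nonneg (sub_nonneg.2 hsu)] at this
    exact (neg_le_abs _).trans this

theorem abs_exp_mul_sub_exp_mul_le_s13 {θ θ' z : ℝ} (hθ : 0 ≤ θ) (hθ' : 0 ≤ θ') (hz : z ≤ 0) :
    |Real.exp (θ * z) - Real.exp (θ' * z)| ≤ |θ' - θ| * (-z) := by
  wlog h : θ ≤ θ' generalizing θ θ'
  · rw [abs_sub_comm, abs_sub_comm θ']
    exact this hθ' hθ (le_of_not_ge h)
  have h1 : Real.exp (θ' * z) ≤ Real.exp (θ * z) :=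
    Real.exp_le_exp.2 (mul_le_mul_of_nonpos_right h hz)
  rw [abs_of_nonneg (sub_nonneg.2 h1), abs_of_nonneg (sub_nonneg.2 h)]
  have h2 : Real.exp (θ' * z) = Real.exp (θ * z) * Real.exp ((θ' - θ) * z) := by
    rw [← Real.exp_add]; ring_nf
  have h3 := Real.add_one_le_exp ((θ' - θ) * z)
  have h4 : Real.exp (θ * z) ≤ 1 := Real.exp_le_one_iff.2 (mul_nonpos_of_nonneg_of_nonpos hθ hz)
  have h5 : 0 ≤ (θ' - θ) * (-z) := mul_nonneg (sub_nonneg.2 h) (neg_nonneg.2 hz)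
  rw [h2]
  nlinarith [Real.exp_pos (θ * z)]

/-- The inner integrand, as a function of the upper time `u` and the integration time `s`. -/
noncomputable def singularIntegrand (a : ℝ → ℝ) (q θ u s : ℝ) : ℝ :=
  (1 - Real.exp (θ * ∫ w in s..u, a w)) * (u - s) ^ q

section SingularIntegrand

variable {a : ℝ → ℝ} {K q θ θ' : ℝ}

theorem measurable_uncurry_singularIntegrand (ha : Continuous a) (q θ : ℝ) :
    Measurable (Function.uncurry (singularIntegrand a q θ)) := by
  have hF : Continuous fun x : ℝ => ∫ w in (0:ℝ)..x, a w :=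
    intervalIntegral.continuous_primitive (fun _ _ => ha.intervalIntegrable _ _) 0
  have h : Function.uncurry (singularIntegrand a q θ) = fun x : ℝ × ℝ =>
      (1 - Real.exp (θ * ((∫ w in (0:ℝ)..x.1, a w) - ∫ w in (0:ℝ)..x.2, a w)))
        * (x.1 - x.2) ^ q := by
    ext ⟨u, s⟩
    simp only [Function.uncurry, singularIntegrand]
    rw [intervalIntegral.integral_interval_sub_left (ha.intervalIntegrable _ _)
      (ha.intervalIntegrable _ _)]
  rw [h]
  refine Measurable.mul ?_ (by fun_prop)
  have h1 : Measurable fun x : ℝ × ℝ => ∫ w in (0:ℝ)..x.1, a w := hF.measurable.comp measurable_fst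
  have h2 : Measurable fun x : ℝ × ℝ => ∫ w in (0:ℝ)..x.2, a w := hF.measurable.comp measurable_snd
  fun_prop

theorem abs_singularIntegrand_sub_le (ha0 : ∀ x, a x ≤ 0)
    (haK : ∀ x, |a x| ≤ K) (hθ : 0 ≤ θ) (hθ' : 0 ≤ θ') {u s : ℝ} (hsu : s < u) :
    |singularIntegrand a q θ' u s - singularIntegrand a q θ u s|
      ≤ |θ' - θ| * K * (u - s) ^ (q + 1) := by
  obtain ⟨h1, h2⟩ := integral_mem_Icc_of_nonpos_of_abs_le ha0 haK hsu.le
  have h3 := abs_exp_mul_sub_exp_mul_le_s13 hθ hθ' h1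
  have hpos : 0 < u - s := sub_pos.2 hsu
  have hq : 0 ≤ (u - s) ^ q := Real.rpow_nonneg hpos.le _
  rw [Real.rpow_add_one hpos.ne']
  unfold singularIntegrand
  rw [← sub_mul, abs_mul, abs_of_nonneg hq, sub_sub_sub_cancel_left]
  calc _ ≤ (|θ' - θ| * (K * (u - s))) * (u - s) ^ q := by gcongr; exact h3.trans (by gcongr)
    _ = _ := by ring

theorem intervalIntegrable_sub_rpow_s13 (hq : -2 < q) (u : ℝ) :
    IntervalIntegrable (fun s => (u - s) ^ (q + 1)) MeasureTheory.volume 0 u := by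
  have := (intervalIntegral.intervalIntegrable_rpow' (a := 0) (b := u)
    (by linarith : -1 < q + 1)).comp_sub_left u
  simpa using this.symm

theorem integral_sub_rpow_s13 (hq : -2 < q) (u : ℝ) :
    ∫ s in (0:ℝ)..u, (u - s) ^ (q + 1) = u ^ (q + 2) / (q + 2) := by
  rw [intervalIntegral.integral_comp_sub_left (fun x => x ^ (q + 1)) u,
    sub_self, sub_zero, integral_rpow (Or.inl (by linarith))]
  rw [show q + 1 + 1 = q + 2 by ring, Real.zero_rpow (by linarith), sub_zero]

theorem intervalIntegrable_singularIntegrand (ha : Continuous a) (ha0 : ∀ x, a x ≤ 0)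
    (haK : ∀ x, |a x| ≤ K) (hq : -2 < q) (hθ : 0 ≤ θ) {u : ℝ} (hu : 0 ≤ u) :
    IntervalIntegrable (singularIntegrand a q θ u) MeasureTheory.volume 0 u := by
  refine ((intervalIntegrable_sub_rpow_s13 hq u).const_mul (|θ - 0| * K)).mono_fun' ?_ ?_
  · exact ((measurable_uncurry_singularIntegrand ha q θ).comp
      measurable_prodMk_left).aestronglyMeasurable
  · rw [Set.uIoc_of_le hu, ← MeasureTheory.restrict_Ioo_eq_restrict_Ioc]
    filter_upwards [MeasureTheory.ae_restrict_mem measurableSet_Ioo] with s hs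
    have := abs_singularIntegrand_sub_le (q := q) ha0 haK le_rfl hθ hs.2
    simpa [singularIntegrand] using this

theorem integral_singularIntegrand_nonneg (ha0 : ∀ x, a x ≤ 0)
    (haK : ∀ x, |a x| ≤ K) (hθ : 0 ≤ θ) {u : ℝ} (hu : 0 ≤ u) :
    0 ≤ ∫ s in (0:ℝ)..u, singularIntegrand a q θ u s := by
  refine intervalIntegral.integral_nonneg hu fun s hs => ?_
  obtain ⟨h1, -⟩ := integral_mem_Icc_of_nonpos_of_abs_le ha0 haK hs.2
  exact mul_nonneg (sub_nonneg.2 (Real.exp_le_one_iff.2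
    (mul_nonpos_of_nonneg_of_nonpos hθ h1))) (Real.rpow_nonneg (sub_nonneg.2 hs.2) _)

theorem abs_integral_singularIntegrand_sub_le (ha : Continuous a) (ha0 : ∀ x, a x ≤ 0)
    (haK : ∀ x, |a x| ≤ K) (hq : -2 < q) (hθ : 0 ≤ θ) (hθ' : 0 ≤ θ') {u : ℝ} (hu : 0 ≤ u) :
    |(∫ s in (0:ℝ)..u, singularIntegrand a q θ' u s) - ∫ s in (0:ℝ)..u, singularIntegrand a q θ u s|
      ≤ |θ' - θ| * K * (u ^ (q + 2) / (q + 2)) := by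
  rw [← intervalIntegral.integral_sub
    (intervalIntegrable_singularIntegrand ha ha0 haK hq hθ' hu)
    (intervalIntegrable_singularIntegrand ha ha0 haK hq hθ hu),
    ← integral_sub_rpow_s13 hq u,
    ← intervalIntegral.integral_const_mul (|θ' - θ| * K) fun s => (u - s) ^ (q + 1)]
  refine (Real.norm_eq_abs _).symm.trans_le <| intervalIntegral.norm_integral_le_of_norm_le hu ?_
    ((intervalIntegrable_sub_rpow_s13 hq u).const_mul _)
  filter_upwards [MeasureTheory.Measure.ae_ne MeasureTheory.volume u] with s hs hs'
  exact abs_singularIntegrand_sub_le ha0 haK hθ hθ' (lt_of_le_of_ne hs'.2 hs)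

theorem aestronglyMeasurable_integral_singularIntegrand (ha : Continuous a) (q θ T : ℝ) :
    MeasureTheory.AEStronglyMeasurable
      (fun u => ∫ s in (0:ℝ)..u, singularIntegrand a q θ u s)
      (MeasureTheory.volume.restrict (Set.Ioc 0 T)) := by
  let S : Set (ℝ × ℝ) := {x | 0 < x.2 ∧ x.2 ≤ x.1}
  have hS : MeasurableSet S :=
    (measurableSet_lt measurable_const measurable_snd).inter
      (measurableSet_le measurable_snd measurable_fst)
  have hm : MeasureTheory.StronglyMeasurable
      (S.indicator (Function.uncurry (singularIntegrand a q θ))) :=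
    ((measurable_uncurry_singularIntegrand ha q θ).indicator hS).stronglyMeasurable
  refine (hm.integral_prod_right' (ν := MeasureTheory.volume)).aestronglyMeasurable.congr ?_
  filter_upwards [MeasureTheory.ae_restrict_mem measurableSet_Ioc] with u hu
  rw [intervalIntegral.integral_of_le hu.1.le,
    ← MeasureTheory.integral_indicator measurableSet_Ioc]
  rfl

/-- The double integral of `b` against the kernel `-(h u ^ (q + 1)) + α ∫ singularIntegrand`. -/
noncomputable def weightedKernelIntegral (a b : ℝ → ℝ) (q h α T θ : ℝ) : ℝ :=
  ∫ u in (0:ℝ)..T, b u * (-(h * u ^ (q + 1)) +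
    α * ∫ s in (0:ℝ)..u, singularIntegrand a q θ u s)

variable {b : ℝ → ℝ} {L h α T : ℝ}

theorem weightedKernelIntegral_nonneg (ha0 : ∀ x, a x ≤ 0)
    (haK : ∀ x, |a x| ≤ K) (hb0 : ∀ x, b x ≤ 0) (hh : 0 ≤ h) (hα : α ≤ 0) (hT : 0 ≤ T)
    (hθ : 0 ≤ θ) : 0 ≤ weightedKernelIntegral a b q h α T θ := by
  refine intervalIntegral.integral_nonneg hT fun u hu => ?_
  have h1 := integral_singularIntegrand_nonneg (q := q) ha0 haK hθ hu.1
  have h2 : 0 ≤ h * u ^ (q + 1) := mul_nonneg hh (Real.rpow_nonneg hu.1 _)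
  have h3 := mul_nonpos_of_nonpos_of_nonneg hα h1
  exact mul_nonneg_of_nonpos_of_nonpos (hb0 u) (by linarith)

theorem intervalIntegrable_weightedKernel (ha : Continuous a) (hb : Continuous b)
    (ha0 : ∀ x, a x ≤ 0) (haK : ∀ x, |a x| ≤ K) (hq : -2 < q) (hT : 0 ≤ T) (hθ : 0 ≤ θ) :
    IntervalIntegrable (fun u => b u * (-(h * u ^ (q + 1)) +
      α * ∫ s in (0:ℝ)..u, singularIntegrand a q θ u s)) MeasureTheory.volume 0 T := by
  refine IntervalIntegrable.continuousOn_mul ?_ hb.continuousOn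
  refine IntervalIntegrable.add (((intervalIntegral.intervalIntegrable_rpow'
    (by linarith)).const_mul h).neg) (IntervalIntegrable.const_mul ?_ α)
  have hr : IntervalIntegrable (fun u : ℝ => |θ - 0| * K * (u ^ (q + 2) / (q + 2)))
      MeasureTheory.volume 0 T :=
    ((intervalIntegral.intervalIntegrable_rpow' (by linarith)).div_const _).const_mul _
  refine hr.mono_fun' ?_ ?_
  · rw [Set.uIoc_of_le hT]
    exact aestronglyMeasurable_integral_singularIntegrand ha q θ T
  · rw [Set.uIoc_of_le hT]
    filter_upwards [MeasureTheory.ae_restrict_mem measurableSet_Ioc] with u hu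
    have := abs_integral_singularIntegrand_sub_le ha ha0 haK hq le_rfl hθ hu.1.le
    simpa [singularIntegrand] using this

theorem abs_weightedKernelIntegral_sub_le (ha : Continuous a) (hb : Continuous b)
    (ha0 : ∀ x, a x ≤ 0) (haK : ∀ x, |a x| ≤ K) (hbL : ∀ x, |b x| ≤ L) (hq : -2 < q)
    (hT : 0 ≤ T) (hθ : 0 ≤ θ) (hθ' : 0 ≤ θ') :
    |weightedKernelIntegral a b q h α T θ' - weightedKernelIntegral a b q h α T θ|
      ≤ L * |α| * K * |θ' - θ| * (T ^ (q + 3) / ((q + 2) * (q + 3))) := by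
  have hL : 0 ≤ L := (abs_nonneg _).trans (hbL 0)
  have hrpow : ∫ u in (0:ℝ)..T, L * |α| * (|θ' - θ| * K * (u ^ (q + 2) / (q + 2)))
      = L * |α| * K * |θ' - θ| * (T ^ (q + 3) / ((q + 2) * (q + 3))) := by
    rw [intervalIntegral.integral_const_mul, intervalIntegral.integral_const_mul,
      intervalIntegral.integral_div, integral_rpow (Or.inl (by linarith)),
      show q + 2 + 1 = q + 3 by ring, Real.zero_rpow (by linarith), sub_zero,
      div_div, mul_comm (q + 3)]
    ring
  unfold weightedKernelIntegral
  rw [← hrpow, ← intervalIntegral.integral_sub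
    (intervalIntegrable_weightedKernel ha hb ha0 haK hq hT hθ')
    (intervalIntegrable_weightedKernel ha hb ha0 haK hq hT hθ)]
  refine (Real.norm_eq_abs _).symm.trans_le <|
    intervalIntegral.norm_integral_le_of_norm_le hT (Filter.Eventually.of_forall ?_)
    ((((intervalIntegral.intervalIntegrable_rpow' (r := q + 2) (by linarith)).div_const _).const_mul
      _).const_mul _)
  intro u hu
  have h1 := abs_integral_singularIntegrand_sub_le ha ha0 haK hq hθ hθ' hu.1.le
  rw [← mul_sub, add_sub_add_left_eq_sub, ← mul_sub, Real.norm_eq_abs, abs_mul, abs_mul,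
    mul_assoc]
  gcongr
  exact hbL u

end SingularIntegrand

theorem existsUnique_nonneg_fixedPoint {f : ℝ → ℝ} {c : ℝ} (hc0 : 0 ≤ c) (hc1 : c < 1)
    (hf0 : ∀ r, 0 ≤ r → 0 ≤ f r)
    (hf : ∀ r r', 0 ≤ r → 0 ≤ r' → |f r' - f r| ≤ c * |r' - r|) :
    ∃! ρ : ℝ, 0 ≤ ρ ∧ f ρ = ρ := by
  have hcon : ContractingWith ⟨c, hc0⟩ fun r => f (max r 0) := by
    refine ⟨by exact_mod_cast hc1, LipschitzWith.of_dist_le_mul fun x y => ?_⟩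
    rw [Real.dist_eq, Real.dist_eq]
    refine (hf _ _ (le_max_right y 0) (le_max_right x 0)).trans ?_
    exact mul_le_mul_of_nonneg_left (abs_max_sub_max_le_abs x y 0) hc0
  have hfix : f (max (ContractingWith.fixedPoint _ hcon) 0) = ContractingWith.fixedPoint _ hcon :=
    hcon.fixedPoint_isFixedPt
  have hpos : 0 ≤ ContractingWith.fixedPoint _ hcon := by
    rw [← hfix]
    exact hf0 _ (le_max_right _ _)
  refine ⟨_, ⟨hpos, by rwa [max_eq_left hpos] at hfix⟩, ?_⟩
  rintro y ⟨hy, hfy⟩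
  refine hcon.fixedPoint_unique ?_
  simpa [Function.IsFixedPt, max_eq_left hy] using hfy

/-- Let `H ∈ (1/3,1/2]`, `T > 0`, `N ≥ 1`, `X^1,…,X^N : [0,T] → ℝ`
continuous, `φ, ψ : ℝ → ℝ` continuous, bounded (by `Kφ`, `Kψ`, the sup-norms) and
nonpositive, `D_N > 0`, `I_N ≥ 0`, `c ∈ (0,1)`, `α_H = H(2H−1)`,
`ᾱ_H = |α_H|/(2H(2H+1))`, `M_N = exp(Kψ |I_N| T)`. If
`ᾱ_H Kφ Kψ T^{2H} M_N ≤ c D_N`, then the map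
`Θ̃_N(r) = (1/(N T D_N)) Σ_i ∫_0^T φ(X_t^i)[−H t^{2H−1}
 + α_H ∫_0^t (1 − exp((r+I_N) ∫_s^t ψ(X_u^i) du))(t−s)^{2H−2} ds] dt`
is nonnegative on `[0,∞)`, `c`-Lipschitz on `[0,∞)`, and admits a unique fixed point in
`[0,∞)`. -/
theorem stmt13 (H T D I c Kφ Kψ : ℝ) (N : ℕ)
    (hH1 : 1/3 < H) (hH2 : H ≤ 1/2) (hT : 0 < T) (hN : 1 ≤ N)
    (X : ℕ → ℝ → ℝ) (hX : ∀ i, ContinuousOn (X i) (Set.Icc 0 T))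
    (φ ψ : ℝ → ℝ) (hφc : Continuous φ) (hψc : Continuous ψ)
    (hφ0 : ∀ y : ℝ, φ y ≤ 0) (hψ0 : ∀ y : ℝ, ψ y ≤ 0)
    (hφb : ∀ y : ℝ, |φ y| ≤ Kφ) (hψb : ∀ y : ℝ, |ψ y| ≤ Kψ)
    (hD : 0 < D) (hI : 0 ≤ I) (hc1 : 0 < c) (hc2 : c < 1)
    (hcond : (|H * (2*H - 1)| / (2*H * (2*H + 1))) * Kφ * Kψ * T ^ (2*H)
        * Real.exp (Kψ * |I| * T) ≤ c * D) :
    let Θ : ℝ → ℝ := fun r =>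
      (1 / (N * T * D)) * ∑ i ∈ Finset.range N,
        ∫ u in (0:ℝ)..T,
          φ (X i u) * (-(H * u ^ (2*H - 1)) + H * (2*H - 1) *
            ∫ s in (0:ℝ)..u,
              (1 - Real.exp ((r + I) * ∫ w in s..u, ψ (X i w))) * (u - s) ^ (2*H - 2))
    (∀ r : ℝ, 0 ≤ r → 0 ≤ Θ r) ∧
    (∀ r r' : ℝ, 0 ≤ r → 0 ≤ r' → |Θ r' - Θ r| ≤ c * |r' - r|) ∧
    (∃! ρ : ℝ, 0 ≤ ρ ∧ Θ ρ = ρ) := by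
  intro Θ
  let Y : ℕ → ℝ → ℝ := fun i => Set.IccExtend hT.le ((Set.Icc 0 T).domRestrict (X i))
  have hY : ∀ i, Continuous (Y i) := fun i =>
    (continuousOn_iff_continuous_domRestrict.1 (hX i)).Icc_extend'
  have hYX : ∀ i, ∀ u ∈ Set.Icc 0 T, Y i u = X i u := fun i u hu =>
    Set.IccExtend_of_mem hT.le _ hu
  have hψY : ∀ i, Continuous fun u => ψ (Y i u) := fun i => hψc.comp (hY i)
  have hφY : ∀ i, Continuous fun u => φ (Y i u) := fun i => hφc.comp (hY i)
  have hα : H * (2*H - 1) ≤ 0 := mul_nonpos_of_nonneg_of_nonpos (by linarith) (by linarith)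
  have hq : -2 < 2*H - 2 := by linarith
  have hNpos : (0:ℝ) < N := by exact_mod_cast hN
  have hΘ : ∀ r, Θ r = (1 / (N * T * D)) * ∑ i ∈ Finset.range N,
      weightedKernelIntegral (fun u => ψ (Y i u)) (fun u => φ (Y i u))
        (2*H - 2) H (H * (2*H - 1)) T (r + I) := by
    intro r
    simp only [Θ]
    congr 1
    refine Finset.sum_congr rfl fun i _ => intervalIntegral.integral_congr fun u hu => ?_
    rw [Set.uIcc_of_le hT.le] at hu
    simp only [hYX i u hu, singularIntegrand, show 2*H - 2 + 1 = 2*H - 1 by ring]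
    congr 3
    refine intervalIntegral.integral_congr fun s hs => ?_
    rw [Set.uIcc_of_le hu.1] at hs
    congr 4
    refine intervalIntegral.integral_congr fun w hw => ?_
    rw [Set.uIcc_of_le hs.2] at hw
    simp only [hYX i w ⟨hs.1.trans hw.1, hw.2.trans hu.2⟩]
  have hnonneg : ∀ r : ℝ, 0 ≤ r → 0 ≤ Θ r := by
    intro r hr
    rw [hΘ]
    exact mul_nonneg (by positivity) (Finset.sum_nonneg fun i _ =>
      weightedKernelIntegral_nonneg (fun _ => hψ0 _) (fun _ => hψb _) (fun _ => hφ0 _)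
        (by linarith) hα hT.le (by linarith))
  have hKφ : 0 ≤ Kφ := (abs_nonneg _).trans (hφb 0)
  have hKψ : 0 ≤ Kψ := (abs_nonneg _).trans (hψb 0)
  have hH : 0 < H := by linarith
  have hconst : (|H * (2*H - 1)| / (2*H * (2*H + 1))) * Kφ * Kψ * T ^ (2*H) ≤ c * D := by
    refine le_trans (le_mul_of_one_le_right (by positivity) ?_) hcond
    exact Real.one_le_exp (by positivity)
  have hlip : ∀ r r' : ℝ, 0 ≤ r → 0 ≤ r' → |Θ r' - Θ r| ≤ c * |r' - r| := by
    intro r r' hr hr'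
    rw [hΘ, hΘ, ← mul_sub, ← Finset.sum_sub_distrib, abs_mul,
      abs_of_pos (by positivity : 0 < 1 / (N * T * D))]
    have hsum := (Finset.abs_sum_le_sum_abs _ _).trans (Finset.sum_le_sum fun i
      (_ : i ∈ Finset.range N) => abs_weightedKernelIntegral_sub_le (h := H)
        (α := H * (2*H - 1)) (hψY i) (hφY i) (fun _ => hψ0 _) (fun _ => hψb _)
        (fun _ => hφb _) hq hT.le (add_nonneg hr hI) (add_nonneg hr' hI))
    rw [Finset.sum_const, Finset.card_range, nsmul_eq_mul, add_sub_add_right_eq_sub,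
      show 2*H - 2 + 3 = 2*H + 1 by ring, show 2*H - 2 + 2 = 2*H by ring,
      Real.rpow_add_one hT.ne'] at hsum
    calc _ ≤ 1 / (N * T * D) * (N * (Kφ * |H * (2*H - 1)| * Kψ * |r' - r| *
          (T ^ (2*H) * T / (2*H * (2*H + 1))))) := by gcongr
      _ = (|H * (2*H - 1)| / (2*H * (2*H + 1))) * Kφ * Kψ * T ^ (2*H) / D * |r' - r| := by
        field_simp
      _ ≤ c * |r' - r| := by
        gcongr
        exact (div_le_iff₀ hD).2 hconst
  exact ⟨hnonneg, hlip, existsUnique_nonneg_fixedPoint hc1.le hc2 hnonneg hlip⟩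
end
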